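/- arXiv:2510.04505 — 6 statements merged into one kernel-verified Lean document; each statement's English description precedes it below -/
import Mathlib

section
/- Assume condition (C_g)(a) and let d > c > 0. If x : [−1,∞) → [0,∞) is a solution of (E_g) on [−1,∞) such that 0 ≤ x(s) ≤ d/c for all s ∈ [−1,0], then 0 ≤ x(t) ≤ d/c for all t ≥ −1, and |x(t₂) − x(t₁)| ≤ 2d·|t₂ − t₁| for all 0 ≤ t₁ < t₂. -/
open Real Set Filter Topology MeasureTheory

noncomputable section

/-- Condition `(C_g)(a)`: `g` maps `[0,∞)` into `[0,1]`, the restriction of `g` to `[0,1]`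
is `C¹` with derivative `g'` (one-sided at the endpoints), `g = 0` on `(1,∞)`,
`g 0 = g' 0 = 0`, `g 1 = 1`, and `g' ξ > g ξ / ξ` for all `ξ ∈ (0,1]`. -/
structure CgA (g g' : ℝ → ℝ) : Prop where
  maps_to : ∀ ξ : ℝ, 0 ≤ ξ → g ξ ∈ Icc (0:ℝ) 1
  hasDeriv : ∀ ξ ∈ Icc (0:ℝ) 1, HasDerivWithinAt g (g' ξ) (Icc (0:ℝ) 1) ξ
  derivCont : ContinuousOn g' (Icc (0:ℝ) 1)
  eq_zero : ∀ ξ : ℝ, 1 < ξ → g ξ = 0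
  g_zero : g 0 = 0
  g'_zero : g' 0 = 0
  g_one : g 1 = 1
  slope : ∀ ξ : ℝ, 0 < ξ → ξ ≤ 1 → g ξ / ξ < g' ξ

/-- `x` is a (nonnegative, continuous) solution on `ℝ` of the delay equation
`x'(t) = -a·x(t) + b·F(x(t-1))`, in integral form. -/
def IsSolR (a b : ℝ) (F x : ℝ → ℝ) : Prop :=
  Continuous x ∧ (∀ t : ℝ, 0 ≤ x t) ∧
    ∀ τ t : ℝ, τ < t →
      IntervalIntegrable (fun s => Real.exp (-a * (t - s)) * F (x (s - 1))) volume τ t ∧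
      x t = Real.exp (-a * (t - τ)) * x τ
          + b * ∫ s in τ..t, Real.exp (-a * (t - s)) * F (x (s - 1))

/-- `x` is a (nonnegative, continuous) solution on `[T₁ - 1, ∞)` of the delay equation
`x'(t) = -a·x(t) + b·F(x(t-1))`, in integral form (identity for `T₁ ≤ τ < t`). -/
def IsSolOn (a b : ℝ) (F : ℝ → ℝ) (T₁ : ℝ) (x : ℝ → ℝ) : Prop :=
  ContinuousOn x (Ici (T₁ - 1)) ∧ (∀ t : ℝ, T₁ - 1 ≤ t → 0 ≤ x t) ∧
    ∀ τ t : ℝ, T₁ ≤ τ → τ < t →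
      IntervalIntegrable (fun s => Real.exp (-a * (t - s)) * F (x (s - 1))) volume τ t ∧
      x t = Real.exp (-a * (t - τ)) * x τ
          + b * ∫ s in τ..t, Real.exp (-a * (t - s)) * F (x (s - 1))

/-- `z` is the solution of `(E_g)` on `[0,∞)` with initial segment `z t = e^{-c t}` on `[0,1]`. -/
def IsZSol (c d : ℝ) (g z : ℝ → ℝ) : Prop :=
  IsSolOn c d g 1 z ∧ ∀ t ∈ Icc (0:ℝ) 1, z t = Real.exp (-c * t)

/-- Condition `(C_{f_n})(a)(b)`: `a n → c`, `b n → d`, each `f n : [0,∞) → [0,1)` is `C¹`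
with derivative `f' n`, `f n 0 = 0`, `f' n > 0` on `(0,1/2]`, the uniform closeness of
`(f n, f' n)` to `(g, g')` away from `1`, and the smallness of
`sup_{[1+κ,∞)}|f' n| · (sup_{[0,∞)}|f' n|)^m`. -/
structure Cfn (c d : ℝ) (g g' : ℝ → ℝ) (a b : ℕ → ℝ) (f f' : ℕ → ℝ → ℝ) : Prop where
  a_pos : ∀ n, 0 < a n
  b_pos : ∀ n, 0 < b n
  a_lim : Tendsto a atTop (nhds c)
  b_lim : Tendsto b atTop (nhds d)
  maps_to : ∀ n, ∀ ξ : ℝ, 0 ≤ ξ → f n ξ ∈ Ico (0:ℝ) 1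
  hasDeriv : ∀ n, ∀ ξ : ℝ, 0 ≤ ξ → HasDerivWithinAt (f n) (f' n ξ) (Ici (0:ℝ)) ξ
  derivCont : ∀ n, ContinuousOn (f' n) (Ici (0:ℝ))
  f_zero : ∀ n, f n 0 = 0
  f'_pos : ∀ n, ∀ ξ : ℝ, 0 < ξ → ξ ≤ 1/2 → 0 < f' n ξ
  close : ∀ κ : ℝ, 0 < κ → κ < 1 → ∀ ε : ℝ, 0 < ε → ∃ N : ℕ, ∀ n ≥ N,
      ∀ ξ : ℝ, (ξ ∈ Icc (0:ℝ) (1 - κ) ∨ 1 + κ ≤ ξ) →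
        |f n ξ - g ξ| + |f' n ξ - g' ξ| < ε
  small : ∀ κ : ℝ, 0 < κ → κ < 1 → ∀ m : ℕ, ∃ A B : ℕ → ℝ,
      (∀ n, ∀ ξ : ℝ, 1 + κ ≤ ξ → |f' n ξ| ≤ A n) ∧
      (∀ n, ∀ ξ : ℝ, 0 ≤ ξ → |f' n ξ| ≤ B n) ∧
      Tendsto (fun n => A n * (B n) ^ m) atTop (nhds 0)

/-- Condition `(H)`. -/
structure CondH (a b ξm ξp : ℝ) (h : ℝ → ℝ) : Prop where
  a_pos : 0 < a
  b_pos : 0 < b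
  ξm_neg : ξm < 0
  ξp_pos : 0 < ξp
  bdd : ∃ M : ℝ, ∀ ξ : ℝ, |h ξ| ≤ M
  smooth : ContDiff ℝ 1 h
  h_zero : h 0 = 0
  slope_zero : a < b * deriv h 0
  zero_m : -a * ξm + b * h ξm = 0
  zero_p : -a * ξp + b * h ξp = 0
  ratio : ∀ ξ : ℝ, ξm < ξ → ξ < ξp → ξ ≠ 0 → a / b < h ξ / ξ
  deriv_pos : ∀ ξ : ℝ, ξ ≠ ξm → ξ ≠ ξp → 0 < deriv h ξ

/-- Solution of `(E_h)`: `u'(t) = -a·u(t) + b·h(u(t-1))` on all of `ℝ`. -/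
def IsSolH (a b : ℝ) (h u : ℝ → ℝ) : Prop :=
  ∀ t : ℝ, HasDerivAt u (-a * u t + b * h (u (t - 1))) t

/-- Solution of `(E_h)` on `[-1,∞)`: continuous there, differentiable on `(0,∞)`
and satisfying the equation for `t > 0`. -/
def IsSolHOn (a b : ℝ) (h u : ℝ → ℝ) : Prop :=
  ContinuousOn u (Ici (-1:ℝ)) ∧
    ∀ t : ℝ, 0 < t → HasDerivAt u (-a * u t + b * h (u (t - 1))) t

/-- Solution of `(E_h)` on `(-∞,0]`. -/
def IsSolHIic (a b : ℝ) (h u : ℝ → ℝ) : Prop :=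
  ContinuousOn u (Iic (0:ℝ)) ∧
    ∀ t : ℝ, t ≤ 0 → HasDerivWithinAt u (-a * u t + b * h (u (t - 1))) (Iic (0:ℝ)) t

/-- boundedness and Lipschitz estimate for solutions of `(E_g)` on `[-1,∞)`
with initial segment in `[0, d/c]`. -/
theorem stmt_0 (c d : ℝ) (g g' : ℝ → ℝ) (hg : CgA g g') (hc : 0 < c) (hcd : c < d)
    (x : ℝ → ℝ) (hx : IsSolOn c d g 0 x)
    (hinit : ∀ s ∈ Icc (-1:ℝ) 0, x s ≤ d / c) :
    (∀ t : ℝ, -1 ≤ t → 0 ≤ x t ∧ x t ≤ d / c) ∧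
    (∀ t₁ t₂ : ℝ, 0 ≤ t₁ → t₁ < t₂ → |x t₂ - x t₁| ≤ 2 * d * |t₂ - t₁|) := by
  obtain ⟨-, hpos, hsol⟩ := hx
  have hd : 0 < d := hc.trans hcd
  have key : ∀ τ t : ℝ, 0 ≤ τ → τ < t → ∃ E I : ℝ, 0 < E ∧ 1 - E ≤ c * (t - τ) ∧ E ≤ 1 ∧
      0 ≤ I ∧ I ≤ (1 - E) / c ∧ x t = E * x τ + d * I := by
    intro τ t h0 hlt
    obtain ⟨hint, heq⟩ := hsol τ t h0 hlt
    have hcont : Continuous (fun s : ℝ => Real.exp (-c * (t - s))) := by fun_prop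
    have hI : ∫ s in τ..t, Real.exp (-c * (t - s)) = (1 - Real.exp (-c * (t - τ))) / c := by
      have hder : ∀ s ∈ uIcc τ t,
          HasDerivAt (fun s => Real.exp (-c * (t - s)) / c) (Real.exp (-c * (t - s))) s := by
        intro s _
        have h1 : HasDerivAt (fun s : ℝ => -c * (t - s)) (-c * (-1)) s :=
          ((hasDerivAt_id s).const_sub t).const_mul (-c)
        have h2 := (h1.exp).div_const c
        have h3 : Real.exp (-c * (t - s)) * (-c * (-1)) / c = Real.exp (-c * (t - s)) := by
          rw [neg_mul_neg, mul_one, mul_div_assoc, div_self hc.ne', mul_one]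
        rw [h3] at h2
        exact h2
      rw [intervalIntegral.integral_eq_sub_of_hasDerivAt hder (hcont.intervalIntegrable _ _)]
      simp
      ring
    refine ⟨Real.exp (-c * (t - τ)), _, Real.exp_pos _, ?_, ?_, ?_, ?_, heq⟩
    · have := Real.add_one_le_exp (-c * (t - τ))
      linarith
    · apply Real.exp_le_one_iff.2
      nlinarith [mul_pos hc (sub_pos.2 hlt)]
    · apply intervalIntegral.integral_nonneg hlt.le
      intro s hs
      exact mul_nonneg (Real.exp_pos _).le
        (hg.maps_to _ (hpos _ (by linarith [hs.1]))).1
    · rw [← hI]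
      apply intervalIntegral.integral_mono_on hlt.le hint (hcont.intervalIntegrable _ _)
      intro s hs
      exact mul_le_of_le_one_right (Real.exp_pos _).le
        (hg.maps_to _ (hpos _ (by linarith [hs.1]))).2
  have bound : ∀ t : ℝ, -1 ≤ t → 0 ≤ x t ∧ x t ≤ d / c := by
    intro t ht
    refine ⟨hpos t (by linarith), ?_⟩
    rcases le_or_gt t 0 with h | h
    · exact hinit t ⟨ht, h⟩
    · obtain ⟨E, I, hE, -, hE1, -, hI, he⟩ := key 0 t le_rfl h
      have h1 : E * x 0 ≤ E * (d / c) :=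
        mul_le_mul_of_nonneg_left (hinit 0 (by simp)) hE.le
      have h2 : d * I ≤ d * ((1 - E) / c) := mul_le_mul_of_nonneg_left hI hd.le
      have h3 : E * (d / c) + d * ((1 - E) / c) = d / c := by ring
      linarith
  refine ⟨bound, ?_⟩
  intro t₁ t₂ h0 hlt
  obtain ⟨E, I, hE, hEc, hE1, hI0, hI, he⟩ := key t₁ t₂ h0 hlt
  obtain ⟨b0, b1⟩ := bound t₁ (by linarith)
  have hs : (1 - E) / c ≤ t₂ - t₁ := by
    rw [div_le_iff₀ hc]; linarith
  have h1 : (1 - E) * x t₁ ≤ (1 - E) * (d / c) :=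
    mul_le_mul_of_nonneg_left b1 (by linarith)
  have h1' : 0 ≤ (1 - E) * x t₁ := mul_nonneg (by linarith) b0
  have h2 : (1 - E) * (d / c) = d * ((1 - E) / c) := by ring
  have h3 : d * ((1 - E) / c) ≤ d * (t₂ - t₁) := mul_le_mul_of_nonneg_left hs hd.le
  have h4 : d * I ≤ d * ((1 - E) / c) := mul_le_mul_of_nonneg_left hI hd.le
  have h5 : 0 ≤ d * I := mul_nonneg hd.le hI0
  have h6 : 0 < d * (t₂ - t₁) := mul_pos hd (by linarith)
  rw [abs_of_pos (sub_pos.2 hlt), abs_le]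
  constructor <;> linarith
end
end

section
/- Assume condition (C_g)(a), d > c > 0, and condition (C_{f_n})(a)(b). Then there exists N ∈ ℕ such that for every n ≥ N: every solution y : [−1,∞) → [0,∞) of (E_{f_n}) on [−1,∞) with 0 ≤ y(s) ≤ 2d/c for all s ∈ [−1,0] satisfies 0 ≤ y(t) ≤ 2d/c for all t ≥ −1 and |y(t₂) − y(t₁)| ≤ 8d·|t₂ − t₁| for all 0 ≤ t₁ < t₂. -/
open Real Set Filter Topology MeasureTheory

noncomputable section

/-- Integral of the exponential kernel. -/
theorem aux_int (a τ t : ℝ) (ha : 0 < a) :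
    ∫ s in τ..t, Real.exp (-a * (t - s)) = (1 - Real.exp (-a * (t - τ))) / a := by
  have h : ∀ s ∈ uIcc τ t, HasDerivAt (fun s => Real.exp (-a * (t - s)) / a)
      (Real.exp (-a * (t - s))) s := by
    intro s _
    have h1 : HasDerivAt (fun s : ℝ => -a * (t - s)) (-a * (-1)) s :=
      ((hasDerivAt_id s).const_sub t).const_mul (-a)
    have h2 := (h1.exp).div_const a
    have h3 : Real.exp (-a * (t - s)) * (-a * (-1)) / a = Real.exp (-a * (t - s)) := by
      rw [div_eq_iff ha.ne']
      ring
    rwa [h3] at h2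
  rw [intervalIntegral.integral_eq_sub_of_hasDerivAt h
    (Continuous.intervalIntegrable (by fun_prop) _ _)]
  simp
  ring

theorem aux_bound (a b : ℝ) (F y : ℝ → ℝ) (ha : 0 < a)
    (hF : ∀ ξ : ℝ, 0 ≤ ξ → F ξ ∈ Ico (0:ℝ) 1) (hy : IsSolOn a b F 0 y)
    (τ t : ℝ) (h0 : 0 ≤ τ) (hτ : τ < t) :
    ∃ I : ℝ, 0 ≤ I ∧ I ≤ (1 - Real.exp (-a * (t - τ))) / a ∧
      y t = Real.exp (-a * (t - τ)) * y τ + b * I := by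
  obtain ⟨_, hpos, hs⟩ := hy
  obtain ⟨hi, he⟩ := hs τ t h0 hτ
  have hb : ∀ s ∈ Icc τ t, F (y (s - 1)) ∈ Ico (0:ℝ) 1 := fun s hs =>
    hF _ (hpos _ (by linarith [hs.1]))
  refine ⟨_, ?_, ?_, he⟩
  · exact intervalIntegral.integral_nonneg hτ.le fun s hs =>
      mul_nonneg (Real.exp_pos _).le (hb s hs).1
  · rw [← aux_int a τ t ha]
    refine intervalIntegral.integral_mono_on hτ.le hi
      (Continuous.intervalIntegrable (by fun_prop) _ _) fun s hs => ?_
    exact mul_le_of_le_one_right (Real.exp_pos _).le (hb s hs).2.le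

/-- for all large `n`, solutions of `(E_{f_n})` on `[-1,∞)` with initial
segment in `[0, 2d/c]` stay in `[0, 2d/c]` and are `8d`-Lipschitz on `[0,∞)`. -/
theorem stmt_1 (c d : ℝ) (g g' : ℝ → ℝ) (hg : CgA g g') (hc : 0 < c) (hcd : c < d)
    (a b : ℕ → ℝ) (f f' : ℕ → ℝ → ℝ) (hf : Cfn c d g g' a b f f') :
    ∃ N : ℕ, ∀ n ≥ N, ∀ y : ℝ → ℝ, IsSolOn (a n) (b n) (f n) 0 y →
      (∀ s ∈ Icc (-1:ℝ) 0, y s ≤ 2 * d / c) →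
      (∀ t : ℝ, -1 ≤ t → 0 ≤ y t ∧ y t ≤ 2 * d / c) ∧
      (∀ t₁ t₂ : ℝ, 0 ≤ t₁ → t₁ < t₂ → |y t₂ - y t₁| ≤ 8 * d * |t₂ - t₁|) := by
  have hd : 0 < d := hc.trans hcd
  have h1 : ∀ᶠ n in atTop, a n < 2 * c := hf.a_lim.eventually_lt_const (by linarith)
  have h2 : ∀ᶠ n in atTop, b n < 2 * d := hf.b_lim.eventually_lt_const (by linarith)
  have h3 : ∀ᶠ n in atTop, b n / a n < 2 * d / c :=
    (hf.b_lim.div hf.a_lim hc.ne').eventually_lt_const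
      (div_lt_div_of_pos_right (by linarith) hc)
  obtain ⟨N, hN⟩ := eventually_atTop.1 (h1.and (h2.and h3))
  refine ⟨N, fun n hn y hy hinit => ?_⟩
  obtain ⟨k1, k2, k3⟩ := hN n hn
  have ha := hf.a_pos n
  have hb := hf.b_pos n
  have hMc : 2 * d / c * c = 2 * d := by field_simp
  have hba : b n / a n * a n = b n := by field_simp
  generalize 2 * d / c = M at *
  have hpos : ∀ t : ℝ, -1 ≤ t → 0 ≤ y t := fun t ht => hy.2.1 t (by linarith)
  have hM : 0 < M := by
    by_contra h
    nlinarith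
  have hup : ∀ t : ℝ, -1 ≤ t → y t ≤ M := by
    intro t ht
    rcases le_or_gt t 0 with h | h
    · exact hinit t ⟨ht, h⟩
    obtain ⟨I, hI0, hI1, e⟩ := aux_bound _ _ _ y ha (hf.maps_to n) hy 0 t le_rfl h
    have hy0 := hinit 0 (by norm_num)
    have hE := Real.exp_pos (-a n * (t - 0))
    have hE1 : Real.exp (-a n * (t - 0)) ≤ 1 := Real.exp_le_one_iff.2 (by nlinarith)
    generalize Real.exp (-a n * (t - 0)) = E at *
    have q1 : E * y 0 ≤ E * M := mul_le_mul_of_nonneg_left hy0 hE.le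
    have q2 : b n * I ≤ b n * ((1 - E) / a n) := mul_le_mul_of_nonneg_left hI1 hb.le
    have q3 : b n * ((1 - E) / a n) = b n / a n * (1 - E) := by ring
    have q4 : b n / a n * (1 - E) ≤ M * (1 - E) :=
      mul_le_mul_of_nonneg_right k3.le (by linarith)
    linarith
  refine ⟨fun t ht => ⟨hpos t ht, hup t ht⟩, fun t₁ t₂ h0 hlt => ?_⟩
  obtain ⟨I, hI0, hI1, e⟩ := aux_bound _ _ _ y ha (hf.maps_to n) hy t₁ t₂ h0 hlt
  have hE1 : Real.exp (-a n * (t₂ - t₁)) ≤ 1 := Real.exp_le_one_iff.2 (by nlinarith)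
  have hE2 := Real.add_one_le_exp (-a n * (t₂ - t₁))
  generalize Real.exp (-a n * (t₂ - t₁)) = E at *
  have hy0 := hpos t₁ (by linarith)
  have hy1 := hup t₁ (by linarith)
  have hs : 0 < t₂ - t₁ := by linarith
  rw [abs_of_pos hs]
  generalize t₂ - t₁ = s at *
  have hI2 : I ≤ s := hI1.trans ((div_le_iff₀ ha).2 (by linarith))
  have q1 : b n * I ≤ 2 * d * s := mul_le_mul k2.le hI2 hI0 (by linarith)
  have q0 : 0 ≤ b n * I := mul_nonneg hb.le hI0
  have q2 : (1 - E) * y t₁ ≤ (a n * s) * M :=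
    mul_le_mul (by linarith) hy1 hy0 (by positivity)
  have q3 : a n * s * M ≤ 2 * c * s * M := by gcongr
  have q4 : 2 * c * s * M = 4 * d * s := by linear_combination 2 * s * hMc
  have q5 : 0 ≤ (1 - E) * y t₁ := mul_nonneg (by linarith) hy0
  have q6 : 0 < d * s := mul_pos hd hs
  rw [abs_le]
  constructor <;> linarith
end
end

section
/- Assume condition (C_g)(a) with d > c > 0 and condition (C_{f_n})(a)(b), and let ξ₁ ∈ (0,1) denote the unique positive zero of ξ ↦ −c·ξ + d·g(ξ) in (0,1]. Let κ ∈ (ξ₁, 1). Then there exists N ∈ ℕ such that for all n ≥ N the map [0,κ] ∋ ξ ↦ −a_n·ξ + b_n·f_n(ξ) has exactly two zeros in [0,κ], namely 0 and a point ξ_{1,n} ∈ (0,κ); moreover ξ_{1,n} → ξ₁ as n → ∞. -/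
open Real Set Filter Topology MeasureTheory

noncomputable section

theorem aux_mono (F F' : ℝ → ℝ) (p q : ℝ) (hp : 0 < p)
    (hd : ∀ x ∈ Icc p q, HasDerivWithinAt F (F' x) (Icc p q) x)
    (hpos : ∀ x ∈ Icc p q, 0 < x * F' x - F x) :
    StrictMonoOn (fun x => F x / x) (Icc p q) := by
  apply strictMonoOn_of_deriv_pos (convex_Icc p q)
  · exact ContinuousOn.div (fun x hx => (hd x hx).continuousWithinAt) continuousOn_id
      (fun x hx => (lt_of_lt_of_le hp hx.1).ne')
  · intro x hx
    rw [interior_Icc] at hx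
    have hx' : x ∈ Icc p q := Ioo_subset_Icc_self hx
    have h0 : 0 < x := hp.trans hx.1
    have h1 : HasDerivAt F (F' x) x := (hd x hx').hasDerivAt (Icc_mem_nhds hx.1 hx.2)
    have h2 := h1.div (hasDerivAt_id x) h0.ne'
    have h3 : deriv (fun x => F x / x) x = (F' x * x - F x * 1) / x ^ 2 := h2.deriv
    rw [h3]
    have := hpos x hx'
    apply div_pos _ (by positivity)
    linarith

theorem aux_uniq (c d : ℝ) (g g' : ℝ → ℝ) (hg : CgA g g') (hc : 0 < c) (hd : 0 < d)
    (a b : ℕ → ℝ) (f f' : ℕ → ℝ → ℝ) (hf : Cfn c d g g' a b f f')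
    (κ : ℝ) (h0 : 0 < κ) (h1 : κ < 1) :
    ∀ᶠ n in atTop, ∀ x ∈ Ioc (0:ℝ) κ, ∀ y ∈ Ioc (0:ℝ) κ,
      -a n * x + b n * f n x = 0 → -a n * y + b n * f n y = 0 → x = y := by
  have hη : 0 < c / (4 * d) := by positivity
  have hgc : ContinuousOn g (Icc 0 1) := fun x hx => (hg.hasDeriv x hx).continuousWithinAt
  obtain ⟨δ₀, hδ₀, hδ⟩ := Metric.continuousOn_iff.1 hg.derivCont 0 (by simp) _ hη
  obtain ⟨δ, hδ1, hδ2⟩ : ∃ δ, 0 < δ ∧ δ < min δ₀ κ := exists_between (lt_min hδ₀ h0)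
  have hδ3 : δ < δ₀ := hδ2.trans_le (min_le_left _ _)
  have hδ4 : δ < κ := hδ2.trans_le (min_le_right _ _)
  have hsub : Icc δ κ ⊆ Icc (0:ℝ) 1 := Icc_subset_Icc hδ1.le h1.le
  have hcont : ContinuousOn (fun x => x * g' x - g x) (Icc δ κ) :=
    (continuousOn_id.mul (hg.derivCont.mono hsub)).sub (hgc.mono hsub)
  obtain ⟨x₀, hx₀, hmin⟩ := isCompact_Icc.exists_isMinOn (nonempty_Icc.2 hδ4.le) hcont
  have hm : 0 < x₀ * g' x₀ - g x₀ := by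
    have hx0 : 0 < x₀ := hδ1.trans_le hx₀.1
    have := hg.slope x₀ hx0 (hx₀.2.trans h1.le)
    rw [div_lt_iff₀ hx0] at this
    linarith
  set m := x₀ * g' x₀ - g x₀ with hmdef
  obtain ⟨N, hN⟩ := hf.close (1 - κ) (by linarith) (by linarith) (min (c / (4*d)) m)
    (lt_min hη hm)
  have hlim : Tendsto (fun n => a n / b n) atTop (nhds (c / d)) :=
    hf.a_lim.div hf.b_lim hd.ne'
  have hlt : c / (4 * d) + c / (4 * d) < c / d := by
    have : c / (4 * d) + c / (4 * d) = (c / d) / 2 := by field_simp; ring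
    rw [this]; exact half_lt_self (by positivity)
  filter_upwards [eventually_ge_atTop N, hlim.eventually (lt_mem_nhds hlt)] with n hn hab
  have key : ∀ x ∈ Ioc (0:ℝ) κ, -a n * x + b n * f n x = 0 → f n x / x = a n / b n := by
    intro x hx h
    rw [div_eq_div_iff hx.1.ne' (hf.b_pos n).ne']
    linarith
  have hlow : ∀ x ∈ Ioc (0:ℝ) κ, -a n * x + b n * f n x = 0 → δ ≤ x := by
    intro x hx h
    by_contra! hxδ
    obtain ⟨y, hy, hy'⟩ := exists_hasDerivAt_eq_slope (f n) (f' n) hx.1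
      (fun y hy => (hf.hasDeriv n y hy.1).continuousWithinAt.mono Icc_subset_Ici_self)
      (fun y hy => (hf.hasDeriv n y hy.1.le).hasDerivAt (Ici_mem_nhds hy.1))
    rw [hf.f_zero, sub_zero, sub_zero, key x hx h] at hy'
    have e1 := hN n hn y (Or.inl ⟨hy.1.le, by linarith [hy.2, hx.2]⟩)
    have e2 := e1.trans_le (min_le_left _ _)
    have e3 := hδ y ⟨hy.1.le, by linarith [hy.2, hx.2]⟩
      (by rw [Real.dist_eq, sub_zero, abs_of_pos hy.1]; linarith [hy.2])
    rw [Real.dist_eq, hg.g'_zero, sub_zero] at e3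
    have := abs_nonneg (f n y - g y)
    have := le_abs_self (f' n y - g' y)
    have := le_abs_self (g' y)
    linarith
  have hmono : StrictMonoOn (fun x => f n x / x) (Icc δ κ) := by
    apply aux_mono (f n) (f' n) δ κ hδ1
    · intro x hx
      exact (hf.hasDeriv n x (hδ1.le.trans hx.1)).mono
        (fun y hy => hδ1.le.trans hy.1)
    · intro x hx
      have hx0 : 0 < x := hδ1.trans_le hx.1
      have hx1 : x ≤ 1 := hx.2.trans h1.le
      have e1 := hN n hn x (Or.inl ⟨hx0.le, by linarith [hx.2]⟩)
      have e2 := e1.trans_le (min_le_right _ _)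
      have e3 : m ≤ x * g' x - g x := hmin hx
      have e4 := le_abs_self (f n x - g x)
      have e5 := neg_abs_le (f' n x - g' x)
      have e6 : x * |f' n x - g' x| ≤ |f' n x - g' x| :=
        mul_le_of_le_one_left (abs_nonneg _) hx1
      have e7 := mul_le_mul_of_nonneg_left e5 hx0.le
      nlinarith
  intro x hx y hy hx' hy'
  exact hmono.injOn ⟨hlow x hx hx', hx.2⟩ ⟨hlow y hy hy', hy.2⟩
    ((key x hx hx').trans (key y hy hy').symm)

theorem aux_sign (c d : ℝ) (g g' : ℝ → ℝ) (hg : CgA g g') (hd : 0 < d)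
    (x y : ℝ) (hx : 0 < x) (hxy : x < y) (hy : y ≤ 1) :
    (-c * x + d * g x = 0 → 0 < -c * y + d * g y) ∧
    (-c * y + d * g y = 0 → -c * x + d * g x < 0) := by
  have hy0 := hx.trans hxy
  have hmono : StrictMonoOn (fun x => g x / x) (Icc x y) := by
    apply aux_mono g g' x y hx
    · intro z hz
      exact (hg.hasDeriv z ⟨hx.le.trans hz.1, hz.2.trans hy⟩).mono
        (Icc_subset_Icc hx.le hy)
    · intro z hz
      have hz0 : 0 < z := hx.trans_le hz.1
      have := hg.slope z hz0 (hz.2.trans hy)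
      rw [div_lt_iff₀ hz0] at this
      linarith
  have h := hmono ⟨le_rfl, hxy.le⟩ ⟨hxy.le, le_rfl⟩ hxy
  simp only at h
  rw [div_lt_div_iff₀ hx hy0] at h
  have h2 := mul_lt_mul_of_pos_left h hd
  constructor
  · intro e
    have : 0 < x * (-c * y + d * g y) := by
      have : y * (-c * x + d * g x) = 0 := by rw [e, mul_zero]
      nlinarith
    exact pos_of_mul_pos_right this hx.le
  · intro e
    have : 0 < y * -(-c * x + d * g x) := by
      have : x * (-c * y + d * g y) = 0 := by rw [e, mul_zero]
      nlinarith
    linarith [pos_of_mul_pos_right this hy0.le]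

/-- for all large `n` the map `ξ ↦ -aₙξ + bₙfₙ(ξ)` has exactly the zeros
`0` and `ξ_{1,n}` in `[0,κ]`, and `ξ_{1,n} → ξ₁`. -/
theorem stmt_2 (c d : ℝ) (g g' : ℝ → ℝ) (hg : CgA g g') (hc : 0 < c) (hcd : c < d)
    (a b : ℕ → ℝ) (f f' : ℕ → ℝ → ℝ) (hf : Cfn c d g g' a b f f')
    (ξ₁ : ℝ) (hξ₁ : ξ₁ ∈ Ioo (0:ℝ) 1) (hzero : -c * ξ₁ + d * g ξ₁ = 0)
    (huniq : ∀ ξ ∈ Ioc (0:ℝ) 1, -c * ξ + d * g ξ = 0 → ξ = ξ₁)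
    (κ : ℝ) (hκ : κ ∈ Ioo ξ₁ 1) :
    ∃ (N : ℕ) (ξs : ℕ → ℝ),
      (∀ n ≥ N, ξs n ∈ Ioo (0:ℝ) κ ∧
        ∀ ξ ∈ Icc (0:ℝ) κ, (-a n * ξ + b n * f n ξ = 0 ↔ ξ = 0 ∨ ξ = ξs n)) ∧
      Tendsto ξs atTop (nhds ξ₁) := by
  have hd : 0 < d := hc.trans hcd
  have hκ0 : 0 < κ := hξ₁.1.trans hκ.1
  have hu := aux_uniq c d g g' hg hc hd a b f f' hf κ hκ0 hκ.2
  have hpt : ∀ x ∈ Icc (0:ℝ) κ, Tendsto (fun n => -a n * x + b n * f n x) atTop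
      (nhds (-c * x + d * g x)) := by
    intro x hx
    have hfx : Tendsto (fun n => f n x) atTop (nhds (g x)) := by
      rw [Metric.tendsto_atTop]
      intro ε hε
      obtain ⟨N, hN⟩ := hf.close (1 - κ) (by linarith [hκ.2]) (by linarith) ε hε
      refine ⟨N, fun n hn => ?_⟩
      have := hN n hn x (Or.inl ⟨hx.1, by linarith [hx.2]⟩)
      rw [Real.dist_eq]
      linarith [abs_nonneg (f' n x - g' x)]
    exact (hf.a_lim.neg.mul_const x).add (hf.b_lim.mul hfx)
  have hex : ∀ p q : ℝ, 0 < p → p < ξ₁ → ξ₁ < q → q ≤ κ → ∀ᶠ n in atTop,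
      ∃ x ∈ Ioo p q, -a n * x + b n * f n x = 0 := by
    intro p q hp hp1 hq hqκ
    have e1 := (aux_sign c d g g' hg hd p ξ₁ hp hp1 hξ₁.2.le).2 hzero
    have e2 := (aux_sign c d g g' hg hd ξ₁ q hξ₁.1 hq (hqκ.trans hκ.2.le)).1 hzero
    filter_upwards [(hpt p ⟨hp.le, by linarith⟩).eventually (gt_mem_nhds e1),
      (hpt q ⟨by linarith, hqκ⟩).eventually (lt_mem_nhds e2)] with n h1 h2
    have hcont : ContinuousOn (fun x => -a n * x + b n * f n x) (Icc p q) := by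
      have : ContinuousOn (f n) (Icc p q) := fun y hy =>
        (hf.hasDeriv n y (hp.le.trans hy.1)).continuousWithinAt.mono
          (fun z hz => hp.le.trans hz.1)
      fun_prop
    exact intermediate_value_Ioo (hp1.trans hq).le hcont ⟨h1, h2⟩
  classical
  let P : ℕ → ℝ → Prop := fun n x => x ∈ Ioo (0:ℝ) κ ∧ -a n * x + b n * f n x = 0
  let ξs : ℕ → ℝ := fun n => if h : ∃ x, P n x then h.choose else 0
  have hP : ∀ᶠ n in atTop, P n (ξs n) := by
    filter_upwards [hex (ξ₁ / 2) κ (by linarith [hξ₁.1]) (by linarith [hξ₁.1]) hκ.1 le_rfl]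
      with n ⟨x, hx, hx'⟩
    have h : ∃ x, P n x := ⟨x, ⟨by linarith [hx.1, hξ₁.1], hx.2⟩, hx'⟩
    have e : ξs n = h.choose := dif_pos h
    rw [e]
    exact h.choose_spec
  obtain ⟨N, hN⟩ := eventually_atTop.1 (hP.and hu)
  refine ⟨N, ξs, ?_, ?_⟩
  · intro n hn
    obtain ⟨⟨h1, h2⟩, h3⟩ := hN n hn
    refine ⟨h1, fun ξ hξ => ⟨fun h => ?_, ?_⟩⟩
    · rcases hξ.1.eq_or_lt with h0 | h0
      · exact Or.inl h0.symm
      · exact Or.inr (h3 ξ ⟨h0, hξ.2⟩ _ ⟨h1.1, h1.2.le⟩ h h2)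
    · rintro (rfl | rfl)
      · rw [hf.f_zero]; ring
      · exact h2
  · rw [tendsto_order]
    have hmain : ∀ p q : ℝ, 0 < p → p < ξ₁ → ξ₁ < q → q ≤ κ →
        ∀ᶠ n in atTop, ξs n ∈ Ioo p q := by
      intro p q hp hp1 hq hqκ
      filter_upwards [hex p q hp hp1 hq hqκ, hP, hu] with n ⟨x, hx, hx'⟩ h1 h3
      have := h3 x ⟨hp.trans hx.1, hx.2.le.trans hqκ⟩ _ ⟨h1.1.1, h1.1.2.le⟩ hx' h1.2
      rwa [← this]
    constructor
    · intro p hp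
      filter_upwards [hmain (max p (ξ₁ / 2)) κ (lt_max_of_lt_right (by linarith [hξ₁.1]))
        (max_lt hp (by linarith [hξ₁.1])) hκ.1 le_rfl] with n hn
      exact (le_max_left _ _).trans_lt hn.1
    · intro q hq
      filter_upwards [hmain (ξ₁ / 2) (min q κ) (by linarith [hξ₁.1])
        (by linarith [hξ₁.1]) (lt_min hq hκ.1) (min_le_right _ _)] with n hn
      exact hn.2.trans_le (min_le_left _ _)
end
end

section
/- Let a > 0 and β > a. Then there exists a unique λ₀ > 0 with λ₀ + a = β·e^{−λ₀}, and for every differentiable function v : ℝ → ℝ satisfying v'(t) = −a·v(t) + β·v(t−1) for all t ∈ ℝ, the following are equivalent: (i) v(t) ≥ 0 for all t ≤ 0, or v(t) ≤ 0 for all t ≤ 0; (ii) there exists α ∈ ℝ such that v(t) = α·e^{λ₀·t} for all t ≤ 0. -/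
open Real Set Filter Topology MeasureTheory

noncomputable section

lemma aux_mvt (G g : ℝ → ℝ) (hG : ∀ t, HasDerivAt G (g t) t) (x y : ℝ) (hxy : x < y) :
    ∃ c, x < c ∧ c < y ∧ G y - G x = g c * (y - x) := by
  obtain ⟨c, hc, h⟩ := exists_hasDerivAt_eq_slope G g hxy
    (fun z _ => (hG z).continuousAt.continuousWithinAt) (fun z _ => hG z)
  refine ⟨c, hc.1, hc.2, ?_⟩
  rw [h]
  field_simp [(sub_pos.2 hxy).ne']

lemma aux_anti (G g : ℝ → ℝ) (hG : ∀ t, HasDerivAt G (g t) t) (hg : ∀ t, g t ≤ 0) (x y : ℝ)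
    (hxy : x ≤ y) : G y ≤ G x := by
  rcases hxy.eq_or_lt with h | h
  · rw [h]
  · obtain ⟨c, _, _, h3⟩ := aux_mvt G g hG x y h
    nlinarith [hg c]

lemma aux_prim (g : ℝ → ℝ) (hg : Continuous g) : ∃ G : ℝ → ℝ, ∀ t, HasDerivAt G (g t) t :=
  ⟨fun t => ∫ s in (0:ℝ)..t, g s, fun t =>
    intervalIntegral.integral_hasDerivAt_right (hg.intervalIntegrable _ _)
      hg.stronglyMeasurable.stronglyMeasurableAtFilter hg.continuousAt⟩

lemma aux_shift (G g : ℝ → ℝ) (hG : ∀ t, HasDerivAt G (g t) t) (t : ℝ) :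
    HasDerivAt (fun s => G (s - 1)) (g (t - 1)) t := by
  simpa using (hG (t - 1)).comp_sub_const t 1

/-- bounded solutions with zero conserved quantity vanish -/
lemma aux_zero (μ : ℝ) (hμ : 0 < μ) (z Z : ℝ → ℝ)
    (hz : ∀ t, HasDerivAt z (μ * (z (t - 1) - z t)) t) (hZ : ∀ t, HasDerivAt Z (z t) t)
    (hc : ∀ t, z t + μ * (Z t - Z (t - 1)) = 0) (B : ℝ) (hB : ∀ t ≤ 0, z t ^ 2 ≤ B) :
    ∀ t ≤ 0, z t = 0 := by
  have hzc : Continuous z := continuous_iff_continuousAt.2 fun t => (hz t).continuousAt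
  obtain ⟨Q, hQ⟩ := aux_prim (fun t => z t ^ 2) (by fun_prop)
  obtain ⟨E, hE⟩ : ∃ E : ℝ → ℝ, ∀ t, E t = z t ^ 2 + μ * (Q t - Q (t - 1)) := ⟨_, fun _ => rfl⟩
  have hE' : ∀ t, HasDerivAt E (-μ * (z (t - 1) - z t) ^ 2) t := by
    intro t
    have h := ((hz t).pow 2).add (((hQ t).sub (aux_shift _ _ hQ t)).const_mul μ)
    have e : E = _ := funext hE
    rw [e]
    refine HasDerivAt.congr_deriv h ?_
    push_cast
    ring
  have hEanti : ∀ x y, x ≤ y → E y ≤ E x := fun x y h =>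
    aux_anti E _ hE' (fun t => by nlinarith [mul_nonneg hμ.le (sq_nonneg (z (t - 1) - z t))]) x y h
  have hQd : ∀ t C, (∀ s, t - 1 ≤ s → s ≤ t → z s ^ 2 ≤ C) → Q t - Q (t - 1) ≤ C := by
    intro t C h
    obtain ⟨c, h1, h2, h3⟩ := aux_mvt Q _ hQ (t - 1) t (by linarith)
    have := h c h1.le h2.le
    rw [h3]; linarith
  have hEB : ∀ t ≤ 0, E t ≤ B + μ * B := by
    intro t ht
    rw [hE]
    have := hQd t B (fun s _ h => hB s (h.trans ht))
    have := mul_le_mul_of_nonneg_left this hμ.le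
    linarith [hB t ht]
  have hEz : ∀ t, z t ^ 2 ≤ E t := by
    intro t
    rw [hE]
    obtain ⟨c, h1, h2, h3⟩ := aux_mvt Q _ hQ (t - 1) t (by linarith)
    rw [h3]
    have : 0 ≤ μ * (z c ^ 2 * (t - (t - 1))) := by
      have := sq_nonneg (z c)
      have : t - (t - 1) = 1 := by ring
      rw [this]; positivity
    linarith
  have key : ∀ r > 0, ∀ t, μ * (E (t - 1) - E t) ≤ r ^ 2 → E t ≤ (1 + 4 * μ) * r ^ 2 := by
    intro r hr t hD
    have osc : ∀ σ : ℝ, σ ^ 2 = 1 → ∀ s, t - 1 ≤ s → s ≤ t → σ * (z t - z s) ≤ r := by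
      intro σ hσ s h1 h2
      have h := aux_anti (fun x => 2 * r * σ * z x - (r ^ 2 * x - μ * E x))
        (fun x => 2 * r * σ * (μ * (z (x - 1) - z x)) - (r ^ 2 * 1 - μ * (-μ * (z (x - 1) - z x) ^ 2)))
        (fun x => ((hz x).const_mul (2 * r * σ)).sub
          (((hasDerivAt_id x).const_mul (r ^ 2)).sub ((hE' x).const_mul μ)))
        (fun x => by
          have e : r ^ 2 = r ^ 2 * σ ^ 2 := by rw [hσ]; ring
          have e2 : (μ * (z (x - 1) - z x)) ^ 2 = σ ^ 2 * (μ * (z (x - 1) - z x)) ^ 2 := by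
            rw [hσ]; ring
          have := sq_nonneg (r - σ * (μ * (z (x - 1) - z x)))
          nlinarith) s t h2
      have h3 := mul_le_mul_of_nonneg_left (hEanti (t - 1) s h1) hμ.le
      have h4 : r ^ 2 * (t - s) ≤ r ^ 2 * 1 := mul_le_mul_of_nonneg_left (by linarith) (sq_nonneg r)
      have h5 : (2 * r) * (σ * (z t - z s)) ≤ (2 * r) * r := by nlinarith
      exact le_of_mul_le_mul_left h5 (by positivity)
    have o1 : ∀ s, t - 1 ≤ s → s ≤ t → z t - z s ≤ r := fun s h1 h2 => by
      simpa using osc 1 (by norm_num) s h1 h2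
    have o2 : ∀ s, t - 1 ≤ s → s ≤ t → z s - z t ≤ r := fun s h1 h2 => by
      simpa using osc (-1) (by norm_num) s h1 h2
    obtain ⟨c, h1, h2, h3⟩ := aux_mvt Z _ hZ (t - 1) t (by linarith)
    have h4 := hc t
    rw [h3] at h4
    have p1 := o1 c h1.le h2.le
    have p2 := o2 c h1.le h2.le
    have b1 : z t ≤ r := by
      by_contra hh
      push Not at hh
      nlinarith
    have b2 : -r ≤ z t := by
      by_contra hh
      push Not at hh
      nlinarith
    have h6 : z t ^ 2 ≤ r ^ 2 := by nlinarith
    have h7 := hQd t (4 * r ^ 2) (fun s h1 h2 => by nlinarith [o1 s h1 h2, o2 s h1 h2])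
    have := mul_le_mul_of_nonneg_left h7 hμ.le
    rw [hE]; linarith
  have small : ∀ t ≤ 0, ∀ r > 0, E t ≤ (1 + 4 * μ) * r ^ 2 := by
    intro t ht r hr
    by_contra hcon
    push Not at hcon
    have hstep : ∀ n : ℕ, r ^ 2 / μ * n ≤ E (t - n) - E t := by
      intro n
      induction n with
      | zero => simp
      | succ n ih =>
        have hm := hEanti (t - n) t (by have : (0:ℝ) ≤ n := n.cast_nonneg; linarith)
        have h1 : r ^ 2 < μ * (E (t - n - 1) - E (t - n)) := by
          by_contra hh
          push Not at hh
          have := key r hr _ hh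
          linarith
        have h2 : r ^ 2 / μ < E (t - n - 1) - E (t - n) := by
          rw [div_lt_iff₀ hμ]; linarith
        push_cast
        rw [show t - ((n:ℝ) + 1) = t - n - 1 by ring]
        linarith
    obtain ⟨n, hn⟩ := exists_nat_gt ((B + μ * B - E t) / (r ^ 2 / μ))
    have hp : 0 < r ^ 2 / μ := by positivity
    rw [div_lt_iff₀ hp] at hn
    have := hstep n
    have := hEB (t - n) (by have : (0:ℝ) ≤ n := n.cast_nonneg; linarith)
    linarith
  intro t ht
  by_contra hne
  have hpos : 0 < z t ^ 2 := by positivity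
  have h1 := hEz t
  have h2 := small t ht (Real.sqrt (z t ^ 2 / (2 * (1 + 4 * μ)))) (by positivity)
  rw [Real.sq_sqrt (by positivity)] at h2
  have : (1 + 4 * μ) * (z t ^ 2 / (2 * (1 + 4 * μ))) = z t ^ 2 / 2 := by field_simp
  linarith

lemma aux_const (μ : ℝ) (hμ : 0 < μ) (u : ℝ → ℝ)
    (hu : ∀ t, HasDerivAt u (μ * (u (t - 1) - u t)) t) (hp : ∀ t ≤ 0, 0 ≤ u t) :
    ∃ α, ∀ t ≤ 0, u t = α := by
  have huc : Continuous u := continuous_iff_continuousAt.2 fun t => (hu t).continuousAt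
  obtain ⟨U, hU⟩ := aux_prim u huc
  obtain ⟨K, hK⟩ : ∃ K, ∀ t, u t + μ * (U t - U (t - 1)) = K := by
    refine ⟨u 0 + μ * (U 0 - U (0 - 1)), fun t => ?_⟩
    have hd : ∀ t, HasDerivAt (fun t => u t + μ * (U t - U (t - 1))) 0 t := fun t => by
      have h := (hu t).add (((hU t).sub (aux_shift _ _ hU t)).const_mul μ)
      refine HasDerivAt.congr_deriv h ?_
      ring
    exact is_const_of_deriv_eq_zero (fun t => (hd t).differentiableAt) (fun t => (hd t).deriv) t 0
  have hub : ∀ t ≤ 0, u t ≤ K := by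
    intro t ht
    obtain ⟨c, h1, h2, h3⟩ := aux_mvt U _ hU (t - 1) t (by linarith)
    have := hK t
    have h4 := hp c (by linarith)
    have : t - (t - 1) = 1 := by ring
    rw [h3, this] at *
    nlinarith [mul_nonneg hμ.le h4]
  obtain ⟨κ, hκ⟩ : ∃ κ, κ * (1 + μ) = K := ⟨K / (1 + μ), by field_simp⟩
  refine ⟨κ, fun t ht => sub_eq_zero.1 ?_⟩
  refine aux_zero μ hμ (fun t => u t - κ) (fun t => U t - κ * t) ?_ ?_ ?_
    (2 * K ^ 2 + 2 * κ ^ 2) ?_ t ht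
  · intro t
    simpa using (hu t).sub_const κ
  · intro t
    refine HasDerivAt.congr_deriv ((hU t).sub ((hasDerivAt_id t).const_mul κ)) ?_
    ring
  · intro t
    have := hK t
    linarith
  · intro t ht
    have h1 := hub t ht
    have h2 := hp t ht
    have : u t ^ 2 ≤ K ^ 2 := by nlinarith
    nlinarith [sq_nonneg (u t + κ)]

lemma aux_pos (a β l : ℝ) (ha : 0 < a) (hl : 0 < l) (h : l + a = β * Real.exp (-l))
    (v : ℝ → ℝ) (hv : ∀ t : ℝ, HasDerivAt v (-a * v t + β * v (t - 1)) t)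
    (hp : ∀ t ≤ 0, 0 ≤ v t) : ∃ α : ℝ, ∀ t : ℝ, t ≤ 0 → v t = α * Real.exp (l * t) := by
  obtain ⟨α, hα⟩ := aux_const (l + a) (by linarith) (fun t => Real.exp (-(l * t)) * v t) (by
    intro t
    have h1 : HasDerivAt (fun t => Real.exp (-(l * t))) (Real.exp (-(l * t)) * (-(l * 1))) t :=
      (((hasDerivAt_id t).const_mul l).neg).exp
    refine HasDerivAt.congr_deriv (h1.mul (hv t)) ?_
    have e : Real.exp (-(l * (t - 1))) = Real.exp (-(l * t)) * Real.exp l := by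
      rw [← Real.exp_add]; ring_nf
    have e2 : (l + a) * Real.exp l = β := by
      rw [h, mul_assoc, ← Real.exp_add]; simp
    rw [e, ← e2]
    ring) (fun t ht => mul_nonneg (Real.exp_pos _).le (hp t ht))
  refine ⟨α, fun t ht => ?_⟩
  rw [← hα t ht, mul_right_comm, ← Real.exp_add]
  simp

/-- for `β > a > 0` there is a unique `λ₀ > 0` with `λ₀ + a = β e^{-λ₀}`, and a
solution on `ℝ` of `v' = -a v + β v(·-1)` is of one sign on `(-∞,0]` iff it equals
`α e^{λ₀ t}` there. -/
theorem stmt_3 (a β : ℝ) (ha : 0 < a) (hβ : a < β) :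
    (∃! l : ℝ, 0 < l ∧ l + a = β * Real.exp (-l)) ∧
    (∀ l : ℝ, 0 < l → l + a = β * Real.exp (-l) →
      ∀ v : ℝ → ℝ, (∀ t : ℝ, HasDerivAt v (-a * v t + β * v (t - 1)) t) →
        (((∀ t : ℝ, t ≤ 0 → 0 ≤ v t) ∨ (∀ t : ℝ, t ≤ 0 → v t ≤ 0)) ↔
          ∃ α : ℝ, ∀ t : ℝ, t ≤ 0 → v t = α * Real.exp (l * t))) := by
  refine ⟨?_, ?_⟩
  · have hcont : Continuous fun l : ℝ => l + a - β * Real.exp (-l) := by fun_prop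
    have hb : 0 < β := ha.trans hβ
    have hmem : (0:ℝ) ∈ Set.Icc ((fun l : ℝ => l + a - β * Real.exp (-l)) 0)
        ((fun l : ℝ => l + a - β * Real.exp (-l)) β) := by
      constructor
      · simp; linarith
      · have : Real.exp (-β) ≤ 1 := Real.exp_le_one_iff.2 (by linarith)
        simp only
        nlinarith
    obtain ⟨l, hl, h0⟩ := intermediate_value_Icc hb.le hcont.continuousOn hmem
    simp only at h0
    have hl0 : l ≠ 0 := by
      rintro rfl
      simp at h0
      linarith
    refine ⟨l, ⟨lt_of_le_of_ne hl.1 hl0.symm, by linarith⟩, ?_⟩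
    rintro y ⟨_, hy⟩
    rcases lt_trichotomy y l with h | h | h
    · have := mul_lt_mul_of_pos_left (Real.exp_lt_exp.2 (neg_lt_neg h)) hb
      linarith
    · exact h
    · have := mul_lt_mul_of_pos_left (Real.exp_lt_exp.2 (neg_lt_neg h)) hb
      linarith
  · intro l hl h v hv
    constructor
    · rintro (hp | hn)
      · exact aux_pos a β l ha hl h v hv hp
      · obtain ⟨α, hα⟩ := aux_pos a β l ha hl h (fun t => -v t) (fun t => by
          refine HasDerivAt.congr_deriv (hv t).neg ?_
          ring) (fun t ht => neg_nonneg.2 (hn t ht))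
        refine ⟨-α, fun t ht => ?_⟩
        have := hα t ht
        linarith
    · rintro ⟨α, hα⟩
      rcases le_total 0 α with h0 | h0
      · left
        intro t ht
        rw [hα t ht]
        exact mul_nonneg h0 (Real.exp_pos _).le
      · right
        intro t ht
        rw [hα t ht]
        exact mul_nonpos_of_nonpos_of_nonneg h0 (Real.exp_pos _).le
end
end

section
/- Assume condition (H). Then there exist solutions u⁻ : ℝ → ℝ and u⁺ : ℝ → ℝ of (E_h) on ℝ such that: (i) u⁻(t) < 0 and (u⁻)'(t) < 0 for all t ∈ ℝ, u⁻ is strictly decreasing, lim_{t→−∞} u⁻(t) = 0 and lim_{t→∞} u⁻(t) = ξ₋; (ii) u⁺(t) > 0 and (u⁺)'(t) > 0 for all t ∈ ℝ, u⁺ is strictly increasing, lim_{t→−∞} u⁺(t) = 0 and lim_{t→∞} u⁺(t) = ξ₊. -/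
open Real Set Filter Topology MeasureTheory

noncomputable section

/-- Euler scheme with delay `N` steps. -/
def eulerSeq (a b : ℝ) (h : ℝ → ℝ) (N : ℕ) (ε : ℝ) : ℕ → ℝ
  | 0 => ε
  | (k+1) => eulerSeq a b h N ε k +
      (1 / (N:ℝ)) * (-a * eulerSeq a b h N ε k + b * h (eulerSeq a b h N ε (k - N)))
termination_by k => k
decreasing_by all_goals omega

structure CoreH (a b ξ : ℝ) (h : ℝ → ℝ) : Prop where
  a_pos : 0 < a
  b_pos : 0 < b
  ξ_pos : 0 < ξ
  smooth : ContDiff ℝ 1 h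
  h_zero : h 0 = 0
  zero : -a * ξ + b * h ξ = 0
  ratio : ∀ x : ℝ, 0 < x → x < ξ → 0 < -a * x + b * h x
  deriv_nn : ∀ x : ℝ, 0 ≤ deriv h x

lemma CoreH.mono {a b ξ : ℝ} {h : ℝ → ℝ} (H : CoreH a b ξ h) : Monotone h :=
  monotone_of_deriv_nonneg (H.smooth.differentiable (by norm_num)) H.deriv_nn

lemma CoreH.lip {a b ξ : ℝ} {h : ℝ → ℝ} (H : CoreH a b ξ h) :
    ∃ L : ℝ, 0 ≤ L ∧ ∀ x ∈ Icc 0 ξ, h x ≤ L * x := by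
  have hc : ContinuousOn (deriv h) (Icc 0 ξ) := (H.smooth.continuous_deriv (by norm_num)).continuousOn
  obtain ⟨L, hL⟩ := isCompact_Icc.exists_bound_of_continuousOn hc
  have h0 : (0:ℝ) ∈ Icc 0 ξ := ⟨le_rfl, H.ξ_pos.le⟩
  refine ⟨L, (norm_nonneg _).trans (hL 0 h0), fun x hx => ?_⟩
  have := Convex.norm_image_sub_le_of_norm_deriv_le (f := h) (s := Icc 0 ξ) (C := L)
    (fun x _ => H.smooth.differentiable (by norm_num) x) hL (convex_Icc _ _) h0 hx
  rw [H.h_zero, sub_zero, sub_zero, Real.norm_eq_abs, Real.norm_eq_abs, abs_of_nonneg hx.1] at this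
  exact (le_abs_self _).trans this

section euler
variable {a b ξ : ℝ} {h : ℝ → ℝ} {N : ℕ} {ε : ℝ}

lemma eulerSeq_succ (k : ℕ) : eulerSeq a b h N ε (k+1) = eulerSeq a b h N ε k +
      (1 / (N:ℝ)) * (-a * eulerSeq a b h N ε k + b * h (eulerSeq a b h N ε (k - N))) := by
  rw [eulerSeq]

lemma eulerSeq_zero : eulerSeq a b h N ε 0 = ε := by
  rw [eulerSeq]

lemma euler_mono (H : CoreH a b ξ h) (hN : 0 < N) (haN : a ≤ N) (hε : 0 < ε) (hεξ : ε < ξ) :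
    Monotone (eulerSeq a b h N ε) := by
  have hN' : (0:ℝ) < N := by exact_mod_cast hN
  have key : ∀ k, ∀ j ≤ k, eulerSeq a b h N ε j ≤ eulerSeq a b h N ε (j+1) := by
    intro k
    induction k with
    | zero =>
      intro j hj
      obtain rfl : j = 0 := by omega
      rw [eulerSeq_succ]
      have : 0 ≤ (1 / (N:ℝ)) * (-a * ε + b * h ε) :=
        mul_nonneg (by positivity) (H.ratio ε hε hεξ).le
      simp only [Nat.zero_sub, eulerSeq_zero]
      linarith
    | succ k ih =>
      intro j hj
      rcases Nat.lt_or_ge j (k+1) with hlt | hge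
      · exact ih j (by omega)
      obtain rfl : j = k + 1 := by omega
      rw [eulerSeq_succ (k+1)]
      have e1 := ih k le_rfl
      have e2 : eulerSeq a b h N ε (k - N) ≤ eulerSeq a b h N ε (k + 1 - N) := by
        rcases Nat.lt_or_ge k N with hk | hk
        · rw [show k - N = k + 1 - N by omega]
        · rw [show k + 1 - N = k - N + 1 by omega]
          exact ih _ (by omega)
      have e3 := H.mono e2
      have e4 := eulerSeq_succ (a := a) (b := b) (h := h) (N := N) (ε := ε) k
      set y := eulerSeq a b h N ε
      have hb := H.b_pos
      have e5 : b * h (y (k - N)) ≤ b * h (y (k+1-N)) := by gcongr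
      have e6 : y (k+1) - y k = (1 / (N:ℝ)) * (-a * y k + b * h (y (k - N))) := by linarith
      have e7 : N * (y (k+1) - y k) = -a * y k + b * h (y (k - N)) := by
        rw [e6]; field_simp
      have : 0 ≤ -a * y (k+1) + b * h (y (k+1-N)) := by nlinarith
      have := mul_nonneg (by positivity : 0 ≤ 1 / (N:ℝ)) this
      linarith
  exact monotone_nat_of_le_succ fun k => key k k le_rfl

lemma euler_pos (H : CoreH a b ξ h) (hN : 0 < N) (haN : a ≤ N) (hε : 0 < ε) (hεξ : ε < ξ) (k : ℕ) :
    ε ≤ eulerSeq a b h N ε k := by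
  have := euler_mono H hN haN hε hεξ (Nat.zero_le k)
  rwa [eulerSeq_zero] at this

lemma euler_le (H : CoreH a b ξ h) (hN : 0 < N) (haN : a ≤ N) (hε : 0 < ε) (hεξ : ε < ξ) (k : ℕ) :
    eulerSeq a b h N ε k ≤ ξ := by
  have hN' : (0:ℝ) < N := by exact_mod_cast hN
  have hm := euler_mono H hN haN hε hεξ
  induction k with
  | zero => rw [eulerSeq_zero]; exact hεξ.le
  | succ k ih =>
    rw [eulerSeq_succ]
    have e1 := H.mono ((hm (Nat.sub_le k N)).trans ih)
    set y := eulerSeq a b h N ε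
    have hb := H.b_pos
    have e5 : b * h (y (k - N)) ≤ b * h ξ := by gcongr
    have hz := H.zero
    have e2 : (1 / (N:ℝ)) * (-a * y k + b * h (y (k - N))) ≤ (1 / (N:ℝ)) * (N * (ξ - y k)) := by
      gcongr
      nlinarith
    have e3 : (1 / (N:ℝ)) * (N * (ξ - y k)) = ξ - y k := by field_simp
    linarith

lemma euler_lim (H : CoreH a b ξ h) (hN : 0 < N) (haN : a ≤ N) (hε : 0 < ε) (hεξ : ε < ξ) :
    Tendsto (eulerSeq a b h N ε) atTop (𝓝 ξ) := by
  have hN' : (0:ℝ) < N := by exact_mod_cast hN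
  have hm := euler_mono H hN haN hε hεξ
  have hle := euler_le H hN haN hε hεξ
  have hge := euler_pos H hN haN hε hεξ
  have hl := tendsto_atTop_ciSup hm ⟨ξ, by rintro _ ⟨k, rfl⟩; exact hle k⟩
  set L := ⨆ i, eulerSeq a b h N ε i
  have hL1 : ε ≤ L := ge_of_tendsto' hl hge
  have hL2 : L ≤ ξ := le_of_tendsto' hl hle
  have t1 : Tendsto (fun k => eulerSeq a b h N ε (k+1)) atTop (𝓝 L) :=
    hl.comp (tendsto_add_atTop_nat 1)
  have t2 : Tendsto (fun k => eulerSeq a b h N ε (k-N)) atTop (𝓝 L) :=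
    hl.comp (tendsto_sub_atTop_nat N)
  have t3 : Tendsto (fun k => eulerSeq a b h N ε (k+1)) atTop
      (𝓝 (L + (1 / (N:ℝ)) * (-a * L + b * h L))) := by
    simp_rw [eulerSeq_succ]
    exact hl.add (((hl.const_mul _).add (((H.smooth.continuous.tendsto L).comp t2).const_mul b)).const_mul _)
  have e := tendsto_nhds_unique t1 t3
  rcases hL2.lt_or_eq with hlt | heq
  · have := mul_pos (by positivity : 0 < 1 / (N:ℝ)) (H.ratio L (hε.trans_le hL1) hlt)
    linarith
  · rwa [heq] at hl

lemma euler_growth (H : CoreH a b ξ h) (hN : 0 < N) (haN : a ≤ N) (hε : 0 < ε) (hεξ : ε < ξ)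
    {L : ℝ} (hL0 : 0 ≤ L) (hL : ∀ x ∈ Icc 0 ξ, h x ≤ L * x) (k : ℕ) :
    eulerSeq a b h N ε k ≤ ε * Real.exp (b * L * (k / N)) := by
  have hN' : (0:ℝ) < N := by exact_mod_cast hN
  have hm := euler_mono H hN haN hε hεξ
  have hle := euler_le H hN haN hε hεξ
  have hge := euler_pos H hN haN hε hεξ
  have ha := H.a_pos
  have hb := H.b_pos
  induction k with
  | zero => simp [eulerSeq_zero]
  | succ k ih =>
    rw [eulerSeq_succ]
    have e1 := H.mono (hm (Nat.sub_le k N))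
    have e2 := hL _ ⟨hε.le.trans (hge k), hle k⟩
    have e0 := hε.trans_le (hge k)
    set y := eulerSeq a b h N ε
    have e3 : b * h (y (k - N)) ≤ b * (L * y k) := by gcongr; linarith
    have e4 : (1 / (N:ℝ)) * (-a * y k + b * h (y (k - N))) ≤ (1 / (N:ℝ)) * (b * (L * y k)) := by
      gcongr
      nlinarith
    have e5 : y k + (1 / (N:ℝ)) * (b * (L * y k)) = y k * (b * L / N + 1) := by field_simp; ring
    have e6 : b * L * (((k+1 : ℕ):ℝ) / N) = b * L * (k / N) + b * L / N := by
      push_cast; field_simp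
    rw [e6, Real.exp_add, ← mul_assoc]
    calc _ ≤ y k * (b * L / N + 1) := by linarith
      _ ≤ y k * Real.exp (b * L / N) := by gcongr; exact Real.add_one_le_exp _
      _ ≤ _ := by gcongr

lemma euler_upper (hN : 0 < N) {k l : ℕ} (hkl : k ≤ l) {C : ℝ}
    (hC : ∀ j, k ≤ j → j < l →
      -a * eulerSeq a b h N ε j + b * h (eulerSeq a b h N ε (j - N)) ≤ C) :
    eulerSeq a b h N ε l - eulerSeq a b h N ε k ≤ ((l:ℝ) - k) / N * C := by
  have hN' : (0:ℝ) < N := by exact_mod_cast hN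
  induction l, hkl using Nat.le_induction with
  | base => simp
  | succ l hl ih =>
    have i1 := ih fun j h1 h2 => hC j h1 (by omega)
    have i2 := hC l hl (by omega)
    rw [eulerSeq_succ]
    have i3 := mul_le_mul_of_nonneg_left i2 (by positivity : 0 ≤ 1 / (N:ℝ))
    have : (((l+1:ℕ):ℝ) - k) / N * C = ((l:ℝ) - k) / N * C + 1 / N * C := by push_cast; ring
    linarith

lemma euler_lower (hN : 0 < N) {k l : ℕ} (hkl : k ≤ l) {C : ℝ}
    (hC : ∀ j, k ≤ j → j < l →
      C ≤ -a * eulerSeq a b h N ε j + b * h (eulerSeq a b h N ε (j - N))) :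
    ((l:ℝ) - k) / N * C ≤ eulerSeq a b h N ε l - eulerSeq a b h N ε k := by
  have hN' : (0:ℝ) < N := by exact_mod_cast hN
  induction l, hkl using Nat.le_induction with
  | base => simp
  | succ l hl ih =>
    have i1 := ih fun j h1 h2 => hC j h1 (by omega)
    have i2 := hC l hl (by omega)
    rw [eulerSeq_succ]
    have i3 := mul_le_mul_of_nonneg_left i2 (by positivity : 0 ≤ 1 / (N:ℝ))
    have : (((l+1:ℕ):ℝ) - k) / N * C = ((l:ℝ) - k) / N * C + 1 / N * C := by push_cast; ring
    linarith

end euler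

lemma approx_exists {a b ξ : ℝ} {h : ℝ → ℝ} (H : CoreH a b ξ h) (n : ℕ) :
    ∃ w : ℝ → ℝ, Monotone w ∧ (∀ t, w t ∈ Icc 0 ξ) ∧ (∀ t < 0, w t ≤ ξ / 2) ∧ ξ / 2 ≤ w 0 ∧
      ∀ s t : ℝ, s < t → -(n:ℝ) ≤ s → ∃ r : ℝ, |r - (t - s)| ≤ 1 / ((n:ℝ) + 1) ∧
        r * (-a * w t + b * h (w (s - 1))) ≤ w t - w s ∧
        w t - w s ≤ r * (-a * w s + b * h (w (t - 1))) := by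
  obtain ⟨L, hL0, hL⟩ := H.lip
  have ha := H.a_pos
  have hb := H.b_pos
  have hξ := H.ξ_pos
  set N : ℕ := n + 1 + ⌈a⌉₊ with hNdef
  have hN : 0 < N := by omega
  have hN' : (0:ℝ) < N := by exact_mod_cast hN
  have haN : a ≤ N := (Nat.le_ceil a).trans (by exact_mod_cast (by omega))
  set ε : ℝ := ξ / 4 * Real.exp (-(b * L * n)) with hεdef
  have hε : 0 < ε := by positivity
  have hε4 : ε ≤ ξ / 4 := by
    have : Real.exp (-(b * L * n)) ≤ 1 := Real.exp_le_one_iff.2 (by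
      have : 0 ≤ b * L * n := by positivity
      linarith)
    rw [hεdef]; nlinarith
  have hεξ : ε < ξ := by linarith
  have hm := euler_mono H hN haN hε hεξ
  have hle := euler_le H hN haN hε hεξ
  have hge := euler_pos H hN haN hε hεξ
  have hgr := euler_growth H hN haN hε hεξ hL0 hL
  have hlim := euler_lim H hN haN hε hεξ
  have hup := @euler_upper a b h N ε hN
  have hlo := @euler_lower a b h N ε hN
  have hex : ∃ k, ξ / 2 ≤ eulerSeq a b h N ε k :=
    ((hlim.eventually (lt_mem_nhds (by linarith : ξ / 2 < ξ))).exists).imp fun k hk => hk.le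
  classical
  obtain ⟨K, hK, hKmin⟩ : ∃ K, ξ / 2 ≤ eulerSeq a b h N ε K ∧
      ∀ j < K, eulerSeq a b h N ε j < ξ / 2 :=
    ⟨Nat.find hex, Nat.find_spec hex, fun j hj => not_le.1 (Nat.find_min hex hj)⟩
  have hK0 : 0 < K := by
    rcases Nat.eq_zero_or_pos K with h0 | h0
    · rw [h0, eulerSeq_zero] at hK; linarith
    · exact h0
  have hKn : n * N ≤ K := by
    by_contra hcon
    push Not at hcon
    have h1 := hK.trans (hgr K)
    have h2 : (K:ℝ) / N ≤ n := by
      rw [div_le_iff₀ hN']; exact_mod_cast hcon.le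
    have h3 : Real.exp (b * L * (K / N)) ≤ Real.exp (b * L * n) := by
      gcongr
    have h4 : ε * Real.exp (b * L * n) = ξ / 4 := by
      rw [hεdef, mul_assoc, ← Real.exp_add]; simp
    have h5 := mul_le_mul_of_nonneg_left h3 hε.le
    linarith
  set y := eulerSeq a b h N ε with hy
  set idx : ℝ → ℕ := fun t => ((K:ℤ) + ⌊(N:ℝ) * t⌋).toNat with hidx
  have hidxm : Monotone idx := by
    intro s t hst
    have : ⌊(N:ℝ) * s⌋ ≤ ⌊(N:ℝ) * t⌋ := Int.floor_le_floor (by gcongr)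
    simp only [hidx]; omega
  have hidx1 : ∀ t, idx (t - 1) = idx t - N := by
    intro t
    have : ⌊(N:ℝ) * (t - 1)⌋ = ⌊(N:ℝ) * t⌋ - N := by
      rw [mul_sub, mul_one]; exact Int.floor_sub_natCast _ _
    simp only [hidx, this]; omega
  refine ⟨fun t => y (idx t), hm.comp hidxm, fun t => ⟨hε.le.trans (hge _), hle _⟩, ?_, ?_, ?_⟩
  · intro t ht
    refine (hKmin _ ?_).le
    have : ⌊(N:ℝ) * t⌋ < 0 := Int.floor_lt.2 (by push_cast; nlinarith)
    simp only [hidx]; omega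
  · have : idx 0 = K := by simp [hidx]
    simpa only [this] using hK
  · intro s t hst hs
    have hkl := hidxm hst.le
    have hfs : -((n * N : ℕ):ℤ) ≤ ⌊(N:ℝ) * s⌋ := Int.le_floor.2 (by push_cast; nlinarith)
    have hft : ⌊(N:ℝ) * s⌋ ≤ ⌊(N:ℝ) * t⌋ := Int.floor_le_floor (by gcongr)
    have cs : ((idx s : ℕ):ℤ) = (K:ℤ) + ⌊(N:ℝ) * s⌋ := by simp only [hidx]; omega
    have ct : ((idx t : ℕ):ℤ) = (K:ℤ) + ⌊(N:ℝ) * t⌋ := by simp only [hidx]; omega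
    have cs' : ((idx s : ℕ):ℝ) = (K:ℝ) + ⌊(N:ℝ) * s⌋ := by exact_mod_cast cs
    have ct' : ((idx t : ℕ):ℝ) = (K:ℝ) + ⌊(N:ℝ) * t⌋ := by exact_mod_cast ct
    refine ⟨((idx t : ℝ) - idx s) / N, ?_, ?_, ?_⟩
    · have f1 := Int.floor_le ((N:ℝ) * s)
      have f2 := Int.lt_floor_add_one ((N:ℝ) * s)
      have f3 := Int.floor_le ((N:ℝ) * t)
      have f4 := Int.lt_floor_add_one ((N:ℝ) * t)
      have e : ((idx t : ℝ) - idx s) / N - (t - s) = ((idx t : ℝ) - idx s - N * (t - s)) / N := by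
        field_simp
      rw [e, abs_div, abs_of_pos hN']
      have hNn : (n:ℝ) + 1 ≤ N := by exact_mod_cast (by omega : n + 1 ≤ N)
      apply div_le_div₀ zero_le_one _ (by positivity) hNn
      rw [cs', ct', abs_le]; constructor <;> linarith
    · refine hlo hkl fun j h1 h2 => ?_
      simp only [hidx1]
      have g1 := hm h2.le
      have g2 := H.mono (hm (Nat.sub_le_sub_right h1 N))
      have : b * h (y (idx s - N)) ≤ b * h (y (j - N)) := by gcongr
      have : a * y j ≤ a * y (idx t) := by gcongr
      linarith
    · refine hup hkl fun j h1 h2 => ?_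
      simp only [hidx1]
      have g1 := hm h1
      have g2 := H.mono (hm (Nat.sub_le_sub_right h2.le N))
      have : b * h (y (j - N)) ≤ b * h (y (idx t - N)) := by gcongr
      have : a * y (idx s) ≤ a * y j := by gcongr
      linarith

lemma limit_exists {a b ξ : ℝ} {h : ℝ → ℝ} (H : CoreH a b ξ h) :
    ∃ v : ℝ → ℝ, Monotone v ∧ (∀ t, v t ∈ Icc 0 ξ) ∧ (∀ t < 0, v t ≤ ξ / 2) ∧ ξ / 2 ≤ v 0 ∧
      ∀ s t : ℝ, s ≤ t →
        (t - s) * (-a * v t + b * h (v (s - 1))) ≤ v t - v s ∧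
        v t - v s ≤ (t - s) * (-a * v s + b * h (v (t - 1))) := by
  choose w hmono hmem hneg hzero hsand using approx_exists H
  have hlim : ∀ t, ∃ x ∈ Icc 0 ξ, Tendsto (fun n => w n t) (hyperfilter ℕ : Filter ℕ) (𝓝 x) := by
    intro t
    have := isCompact_Icc.ultrafilter_le_nhds ((hyperfilter ℕ).map fun n => w n t)
      (s := Icc 0 ξ) (by
        rw [Ultrafilter.coe_map, le_principal_iff]
        exact Filter.mem_map.2 (Filter.univ_mem' fun n => hmem n t))
    exact this
  choose v hv hvt using hlim
  have hat : (hyperfilter ℕ : Filter ℕ) ≤ atTop := by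
    rw [← Nat.cofinite_eq_atTop]; exact hyperfilter_le_cofinite
  refine ⟨v, ?_, hv, ?_, ?_, ?_⟩
  · intro s t hst
    exact le_of_tendsto_of_tendsto' (hvt s) (hvt t) fun n => hmono n hst
  · intro t ht
    exact le_of_tendsto' (hvt t) fun n => hneg n t ht
  · exact ge_of_tendsto' (hvt 0) hzero
  · intro s t hst
    rcases hst.eq_or_lt with rfl | hst
    · simp
    have hr : ∀ n : ℕ, ∃ r : ℝ, -(n:ℝ) ≤ s → |r - (t - s)| ≤ 1 / ((n:ℝ) + 1) ∧
        r * (-a * w n t + b * h (w n (s - 1))) ≤ w n t - w n s ∧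
        w n t - w n s ≤ r * (-a * w n s + b * h (w n (t - 1))) := by
      intro n
      by_cases hn : -(n:ℝ) ≤ s
      · obtain ⟨r, hr⟩ := hsand n s t hst hn
        exact ⟨r, fun _ => hr⟩
      · exact ⟨0, fun h => absurd h hn⟩
    choose r hr using hr
    have hev : ∀ᶠ n : ℕ in atTop, -(n:ℝ) ≤ s := by
      filter_upwards [tendsto_natCast_atTop_atTop.eventually_ge_atTop (-s)] with n hn
      linarith
    have hrt : Tendsto r atTop (𝓝 (t - s)) := by
      rw [tendsto_iff_norm_sub_tendsto_zero]
      refine squeeze_zero' (Eventually.of_forall fun n => norm_nonneg _) ?_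
        (tendsto_one_div_add_atTop_nhds_zero_nat (𝕜 := ℝ))
      filter_upwards [hev] with n hn using (hr n hn).1
    have hrt' := hrt.mono_left hat
    have hev' := hat hev
    have hc : ∀ x, Tendsto (fun n => h (w n x)) (hyperfilter ℕ : Filter ℕ) (𝓝 (h (v x))) :=
      fun x => (H.smooth.continuous.tendsto _).comp (hvt x)
    constructor
    · refine le_of_tendsto_of_tendsto
        (hrt'.mul (((hvt t).const_mul (-a)).add ((hc (s-1)).const_mul b))) ((hvt t).sub (hvt s)) ?_
      filter_upwards [hev'] with n hn using (hr n hn).2.1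
    · refine le_of_tendsto_of_tendsto ((hvt t).sub (hvt s))
        (hrt'.mul (((hvt s).const_mul (-a)).add ((hc (t-1)).const_mul b))) ?_
      filter_upwards [hev'] with n hn using (hr n hn).2.2

lemma core_exists {a b ξ : ℝ} {h : ℝ → ℝ} (H : CoreH a b ξ h) :
    ∃ u : ℝ → ℝ, IsSolH a b h u ∧ (∀ t : ℝ, 0 < u t ∧ 0 < deriv u t) ∧ StrictMono u ∧
      Tendsto u atBot (nhds 0) ∧ Tendsto u atTop (nhds ξ) := by
  obtain ⟨v, hm, hmem, hneg, hzero, hs⟩ := limit_exists H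
  have ha := H.a_pos
  have hb := H.b_pos
  have hξ := H.ξ_pos
  have hhc := H.smooth.continuous
  -- continuity
  have hlip : ∀ s t, s ≤ t → v t - v s ≤ (t - s) * (b * h ξ) := by
    intro s t hst
    refine (hs s t hst).2.trans ?_
    have h1 := H.mono (hmem (t-1)).2
    have h2 : b * h (v (t-1)) ≤ b * h ξ := by gcongr
    have h3 : 0 ≤ a * v s := mul_nonneg ha.le (hmem s).1
    exact mul_le_mul_of_nonneg_left (by linarith) (by linarith)
  have hhξ : 0 ≤ b * h ξ := by
    have := H.zero
    nlinarith
  have hcont : Continuous v := by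
    have : LipschitzWith (Real.toNNReal (b * h ξ)) v := by
      refine LipschitzWith.of_le_add_mul _ fun x y => ?_
      rw [Real.coe_toNNReal _ hhξ, Real.dist_eq]
      rcases le_total x y with hxy | hxy
      · have := hm hxy
        have : 0 ≤ b * h ξ * |x - y| := by positivity
        linarith
      · have := hlip y x hxy
        rw [abs_of_nonneg (by linarith)]
        linarith
    exact this.continuous
  have hsol : IsSolH a b h v := by
    intro t
    rw [hasDerivAt_iff_tendsto_slope]
    have c1 : Continuous fun y => -a * v (max t y) + b * h (v (min t y - 1)) := by fun_prop
    have c2 : Continuous fun y => -a * v (min t y) + b * h (v (max t y - 1)) := by fun_prop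
    have t1 := (c1.tendsto t).mono_left (nhdsWithin_le_nhds (s := {t}ᶜ))
    have t2 := (c2.tendsto t).mono_left (nhdsWithin_le_nhds (s := {t}ᶜ))
    simp only [max_self, min_self] at t1 t2
    refine tendsto_of_tendsto_of_tendsto_of_le_of_le' t1 t2 ?_ ?_
    · filter_upwards [self_mem_nhdsWithin] with y hy
      rcases lt_or_gt_of_ne (show y ≠ t from hy) with hlt | hlt
      · rw [max_eq_left hlt.le, min_eq_right hlt.le, slope_comm, slope_def_field,
          le_div_iff₀ (by linarith), mul_comm]
        exact (hs y t hlt.le).1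
      · rw [max_eq_right hlt.le, min_eq_left hlt.le, slope_def_field,
          le_div_iff₀ (by linarith), mul_comm]
        exact (hs t y hlt.le).1
    · filter_upwards [self_mem_nhdsWithin] with y hy
      rcases lt_or_gt_of_ne (show y ≠ t from hy) with hlt | hlt
      · rw [max_eq_left hlt.le, min_eq_right hlt.le, slope_comm, slope_def_field,
          div_le_iff₀ (by linarith), mul_comm]
        exact (hs y t hlt.le).2
      · rw [max_eq_right hlt.le, min_eq_left hlt.le, slope_def_field,
          div_le_iff₀ (by linarith), mul_comm]
        exact (hs t y hlt.le).2
  -- limits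
  have heq : ∀ ℓ : ℝ, 0 ≤ ℓ → ℓ ≤ ξ → -a * ℓ + b * h ℓ = 0 → ℓ = 0 ∨ ℓ = ξ := by
    intro ℓ h0 h1 he
    rcases h0.eq_or_lt with h0 | h0
    · exact Or.inl h0.symm
    rcases h1.eq_or_lt with h1 | h1
    · exact Or.inr h1
    have := H.ratio ℓ h0 h1
    linarith
  have hequil : ∀ (F : Filter ℝ) [F.NeBot] (ℓ : ℝ), Tendsto (fun t => t - 1) F F →
      Tendsto v F (𝓝 ℓ) → -a * ℓ + b * h ℓ = 0 := by
    intro F _ ℓ hF hv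
    have v1 : Tendsto (fun t => v (t - 1)) F (𝓝 ℓ) := hv.comp hF
    have v2 : Tendsto (fun t => v (t - 1 - 1)) F (𝓝 ℓ) := v1.comp hF
    have hd : Tendsto (fun t => v t - v (t - 1)) F (𝓝 0) := by simpa using hv.sub v1
    have l1 : -a * ℓ + b * h ℓ ≤ 0 := by
      refine le_of_tendsto_of_tendsto'
        ((hv.const_mul (-a)).add (((hhc.tendsto ℓ).comp v2).const_mul b)) hd fun t => ?_
      have := (hs (t-1) t (by linarith)).1
      simpa using this
    have l2 : 0 ≤ -a * ℓ + b * h ℓ := by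
      refine le_of_tendsto_of_tendsto' hd
        ((v1.const_mul (-a)).add (((hhc.tendsto ℓ).comp v1).const_mul b)) fun t => ?_
      have := (hs (t-1) t (by linarith)).2
      simpa using this
    linarith
  have htop : Tendsto v atTop (𝓝 ξ) := by
    have hl := tendsto_atTop_ciSup hm ⟨ξ, by rintro _ ⟨k, rfl⟩; exact (hmem k).2⟩
    set ℓ := ⨆ i, v i
    have h2 : ℓ ≤ ξ := le_of_tendsto' hl fun t => (hmem t).2
    have h1 : ξ / 2 ≤ ℓ := ge_of_tendsto hl (by
      filter_upwards [eventually_ge_atTop 0] with t ht using hzero.trans (hm ht))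
    have he := hequil atTop ℓ (tendsto_atTop_add_const_right _ (-1) tendsto_id) hl
    rcases heq ℓ (by linarith) h2 he with h3 | h3
    · linarith
    · rwa [h3] at hl
  have hbot : Tendsto v atBot (𝓝 0) := by
    have hl := tendsto_atBot_ciInf hm ⟨0, by rintro _ ⟨k, rfl⟩; exact (hmem k).1⟩
    set ℓ := ⨅ i, v i
    have h1 : 0 ≤ ℓ := ge_of_tendsto' hl fun t => (hmem t).1
    have h2 : ℓ ≤ ξ / 2 := le_of_tendsto hl (by
      filter_upwards [eventually_lt_atBot 0] with t ht using hneg t ht)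
    have he := hequil atBot ℓ (tendsto_atBot_add_const_right _ (-1) tendsto_id) hl
    rcases heq ℓ h1 (by linarith) he with h3 | h3
    · rwa [h3] at hl
    · linarith
  -- positivity
  have hpos : ∀ t, 0 < v t := by
    intro t
    by_contra hcon
    push Not at hcon
    have key : ∀ n : ℕ, v (t + n) ≤ 0 := by
      intro n
      induction n with
      | zero => simpa using hcon
      | succ n ih =>
        have e0 : v (t + n) = 0 := le_antisymm ih (hmem _).1
        have := (hs (t + n) (t + n + 1) (by linarith)).2
        rw [add_sub_cancel_right, e0, H.h_zero] at this
        push_cast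
        rw [← add_assoc]
        linarith
    obtain ⟨n, hn⟩ := exists_nat_ge (-t)
    have := key n
    have := hm (show 0 ≤ t + n by linarith)
    linarith
  have hdpos : ∀ t, 0 < deriv v t := by
    intro t0
    by_contra hcon
    push Not at hcon
    set g : ℝ → ℝ := fun t => -a * v t + b * h (v (t - 1)) with hg
    have hvg : ∀ t, HasDerivAt v (g t) t := hsol
    have hg0 : ∀ t, 0 ≤ g t := by
      intro t
      rw [← (hvg t).deriv]; exact hm.deriv_nonneg
    have hgd : ∀ t, HasDerivAt g (-a * g t + b * (deriv h (v (t-1)) * g (t - 1))) t := by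
      intro t
      have d1 : HasDerivAt (fun t => v (t - 1)) (g (t - 1)) t := (hvg (t-1)).comp_sub_const t 1
      have d2 : HasDerivAt h (deriv h (v (t-1))) (v (t-1)) :=
        (H.smooth.differentiable (by norm_num) _).hasDerivAt
      have d3 := d2.comp t d1
      exact ((hvg t).const_mul (-a)).add (d3.const_mul b)
    have hGd : ∀ t, HasDerivAt (fun t => Real.exp (a * t) * g t)
        (Real.exp (a * t) * (b * (deriv h (v (t-1)) * g (t - 1)))) t := by
      intro t
      have d1 : HasDerivAt (fun t => Real.exp (a * t)) (Real.exp (a * t) * (a * 1)) t :=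
        ((hasDerivAt_id t).const_mul a).exp
      refine (d1.fun_mul (hgd t)).congr_deriv ?_
      ring
    have hGm : Monotone (fun t => Real.exp (a * t) * g t) := by
      refine monotone_of_deriv_nonneg (fun t => (hGd t).differentiableAt) fun t => ?_
      rw [(hGd t).deriv]
      have := H.deriv_nn (v (t-1))
      have := hg0 (t-1)
      positivity
    have hgz : ∀ t ≤ t0, g t ≤ 0 := by
      intro t ht
      rw [(hvg t0).deriv] at hcon
      have h1 := hGm ht
      have h2 : Real.exp (a * t0) * g t0 ≤ 0 := mul_nonpos_of_nonneg_of_nonpos (Real.exp_pos _).le hcon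
      by_contra hh
      push Not at hh
      have := mul_pos (Real.exp_pos (a * t)) hh
      simp only at h1
      linarith
    have hanti : AntitoneOn v (Iic t0) := by
      refine antitoneOn_of_deriv_nonpos (convex_Iic _) hcont.continuousOn
        (fun t _ => (hvg t).differentiableAt.differentiableWithinAt) fun t ht => ?_
      rw [(hvg t).deriv]
      exact hgz t (mem_Iic.1 (interior_subset ht))
    have : v t0 ≤ 0 := ge_of_tendsto hbot (by
      filter_upwards [eventually_le_atBot t0] with t ht
      exact hanti ht (mem_Iic.2 le_rfl) ht)
    linarith [hpos t0]
  exact ⟨v, hsol, fun t => ⟨hpos t, hdpos t⟩, strictMono_of_deriv_pos hdpos, hbot, htop⟩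

lemma CondH.deriv_nn {a b ξm ξp : ℝ} {h : ℝ → ℝ} (H : CondH a b ξm ξp h) (x : ℝ) :
    0 ≤ deriv h x := by
  have hc : Continuous (deriv h) := H.smooth.continuous_deriv (by norm_num)
  have hcl : IsClosed {x | 0 ≤ deriv h x} := isClosed_le continuous_const hc
  have hd : Dense (({ξm, ξp} : Set ℝ)ᶜ) := (Set.toFinite ({ξm, ξp} : Set ℝ)).countable.dense_compl ℝ
  have hsub : ({ξm, ξp} : Set ℝ)ᶜ ⊆ {x | 0 ≤ deriv h x} := by
    intro y hy
    simp only [mem_compl_iff, mem_insert_iff, mem_singleton_iff, not_or] at hy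
    exact (H.deriv_pos y hy.1 hy.2).le
  exact (hcl.closure_subset_iff.2 hsub) (hd x)

lemma CondH.corep {a b ξm ξp : ℝ} {h : ℝ → ℝ} (H : CondH a b ξm ξp h) : CoreH a b ξp h where
  a_pos := H.a_pos
  b_pos := H.b_pos
  ξ_pos := H.ξp_pos
  smooth := H.smooth
  h_zero := H.h_zero
  zero := H.zero_p
  deriv_nn := H.deriv_nn
  ratio := by
    intro x h0 h1
    have := H.ratio x (H.ξm_neg.trans h0) h1 h0.ne'
    rw [div_lt_div_iff₀ H.b_pos h0] at this
    linarith

lemma CondH.corem {a b ξm ξp : ℝ} {h : ℝ → ℝ} (H : CondH a b ξm ξp h) :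
    CoreH a b (-ξm) (fun x => -h (-x)) where
  a_pos := H.a_pos
  b_pos := H.b_pos
  ξ_pos := neg_pos.2 H.ξm_neg
  smooth := (H.smooth.comp contDiff_neg).neg
  h_zero := by simp [H.h_zero]
  zero := by have := H.zero_m; simp only [neg_neg]; linarith
  deriv_nn := by
    intro x
    have d : HasDerivAt h (deriv h (-x)) (-x) :=
      (H.smooth.differentiable (by norm_num) _).hasDerivAt
    have d2 : HasDerivAt (fun x => -h (-x)) (-(deriv h (-x) * (-1))) x :=
      (d.comp x (hasDerivAt_neg x)).neg
    rw [d2.deriv]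
    have := H.deriv_nn (-x)
    linarith
  ratio := by
    intro x h0 h1
    have h2 : -x < 0 := by linarith
    have := H.ratio (-x) (by linarith) (h2.trans H.ξp_pos) h2.ne
    rw [div_neg, ← neg_div, div_lt_div_iff₀ H.b_pos h0] at this
    linarith

/-- under condition `(H)` there exist a negative strictly decreasing
solution `u⁻` connecting `0` to `ξ₋` and a positive strictly increasing solution `u⁺`
connecting `0` to `ξ₊`, with negative resp. positive derivative. -/
theorem stmt_4 (a b ξm ξp : ℝ) (h : ℝ → ℝ) (hH : CondH a b ξm ξp h) :
    ∃ um up : ℝ → ℝ,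
      IsSolH a b h um ∧ IsSolH a b h up ∧
      (∀ t : ℝ, um t < 0 ∧ deriv um t < 0) ∧ StrictAnti um ∧
      Tendsto um atBot (nhds 0) ∧ Tendsto um atTop (nhds ξm) ∧
      (∀ t : ℝ, 0 < up t ∧ 0 < deriv up t) ∧ StrictMono up ∧
      Tendsto up atBot (nhds 0) ∧ Tendsto up atTop (nhds ξp) := by
  obtain ⟨up, p1, p2, p3, p4, p5⟩ := core_exists hH.corep
  obtain ⟨w, m1, m2, m3, m4, m5⟩ := core_exists hH.corem
  refine ⟨fun t => -w t, up, ?_, p1, ?_, m3.neg, ?_, ?_, p2, p3, p4, p5⟩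
  · intro t
    refine (m1 t).fun_neg.congr_deriv ?_
    ring
  · intro t
    have e : deriv (fun t => -w t) t = -deriv w t := deriv.fun_neg
    rw [e]
    exact ⟨neg_neg_of_pos (m2 t).1, neg_neg_of_pos (m2 t).2⟩
  · simpa using m4.neg
  · simpa using m5.neg
end
end

section
/- Assume condition (H), and fix κ⁺ ∈ (0, ξ₊) and κ⁻ ∈ (ξ₋, 0). Then: (i) there is exactly one solution u : ℝ → ℝ of (E_h) on ℝ with u(t) ∈ [0, κ⁺] for all t ≤ 0 and u(0) = κ⁺, and this u is strictly increasing on ℝ with lim_{t→−∞} u(t) = 0 and lim_{t→∞} u(t) = ξ₊; (ii) there is exactly one solution v : ℝ → ℝ of (E_h) on ℝ with v(t) ∈ [κ⁻, 0] for all t ≤ 0 and v(0) = κ⁻, and this v is strictly decreasing on ℝ with lim_{t→−∞} v(t) = 0 and lim_{t→∞} v(t) = ξ₋. -/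
open Real Set Filter Topology MeasureTheory

noncomputable section

/-- One-sided core hypotheses. -/
structure CoreH_s5 (a b ξ B : ℝ) (h : ℝ → ℝ) : Prop where
  ha : 0 < a
  hb : 0 < b
  hξ : 0 < ξ
  cont : Continuous h
  mono : Monotone h
  h0 : h 0 = 0
  hB : a < B
  near : ∀ p q : ℝ, p < B → B < q → ∃ x0 > 0, ∀ x y : ℝ, |x| ≤ x0 → |y| ≤ x0 → x ≤ y →
    p * (y - x) ≤ b * (h y - h x) ∧ b * (h y - h x) ≤ q * (y - x)
  zero : b * h ξ = a * ξ
  pos : ∀ x : ℝ, 0 < x → x < ξ → a * x < b * h x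

lemma exp_mono_aux {k : ℝ} {f g : ℝ → ℝ} {s t : ℝ} (hst : s ≤ t)
    (hc : ContinuousOn f (Icc s t))
    (hd : ∀ r ∈ Ioo s t, HasDerivAt f (-k * f r + g r) r)
    (hg : ∀ r ∈ Ioo s t, 0 ≤ g r) : f s * exp (k * s) ≤ f t * exp (k * t) := by
  have key : ∀ r ∈ Ioo s t, HasDerivAt (fun r => f r * exp (k * r)) (g r * exp (k * r)) r := by
    intro r hr
    have h1 : HasDerivAt (fun r : ℝ => exp (k * r)) (exp (k * r) * k) r := by
      simpa using ((hasDerivAt_id r).const_mul k).exp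
    have h2 := (hd r hr).mul h1
    refine h2.congr_deriv ?_
    ring
  have : MonotoneOn (fun r => f r * exp (k * r)) (Icc s t) := by
    apply monotoneOn_of_deriv_nonneg (convex_Icc s t)
    · apply hc.mul
      fun_prop
    · rw [interior_Icc]
      intro r hr
      exact (key r hr).differentiableAt.differentiableWithinAt
    · rw [interior_Icc]
      intro r hr
      rw [(key r hr).deriv]
      have := hg r hr
      positivity
  exact this ⟨le_rfl, hst⟩ ⟨hst, le_rfl⟩ hst

lemma IsSolH.cont {a b : ℝ} {h u : ℝ → ℝ} (hu : IsSolH a b h u) : Continuous u :=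
  continuous_iff_continuousAt.2 fun t => (hu t).continuousAt

lemma forward_unique {a b : ℝ} {h u v : ℝ → ℝ} (hu : IsSolH a b h u) (hv : IsSolH a b h v)
    (T : ℝ) (he : ∀ t ≤ T, u t = v t) : u = v := by
  have step : ∀ n : ℕ, ∀ t ≤ T + n, u t = v t := by
    intro n
    induction n with
    | zero => simpa using he
    | succ n ih =>
      intro t ht
      push_cast at ht
      rcases le_total t (T + n) with h1 | h1
      · exact ih t h1
      have e0 : u (T + n) = v (T + n) := ih _ le_rfl
      have A := exp_mono_aux (k := a) (f := fun r => u r - v r) (g := fun _ => 0) h1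
        ((hu.cont.sub hv.cont).continuousOn) (by
          intro r hr
          have e := ih (r - 1) (by linarith [hr.2])
          refine ((hu r).sub (hv r)).congr_deriv ?_
          rw [e]; ring) (by simp)
      have A' := exp_mono_aux (k := a) (f := fun r => v r - u r) (g := fun _ => 0) h1
        ((hv.cont.sub hu.cont).continuousOn) (by
          intro r hr
          have e := ih (r - 1) (by linarith [hr.2])
          refine ((hv r).sub (hu r)).congr_deriv ?_
          rw [e]; ring) (by simp)
      simp only [e0, sub_self, zero_mul] at A A'
      have hp := exp_pos (a * t)
      have B1 := nonneg_of_mul_nonneg_left A hp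
      have B2 := nonneg_of_mul_nonneg_left A' hp
      linarith
  funext t
  obtain ⟨n, hn⟩ := exists_nat_ge (t - T)
  exact step n t (by linarith)

/-- strict order on a unit interval propagates -/
lemma forward_order {a b : ℝ} {h u v : ℝ → ℝ} (hb : 0 < b) (hm : Monotone h)
    (hu : IsSolH a b h u) (hv : IsSolH a b h v)
    (T : ℝ) (he : ∀ t ∈ Icc (T - 1) T, v t < u t) : ∀ t, T ≤ t → v t < u t := by
  have step : ∀ n : ℕ, ∀ t ∈ Icc (T - 1) (T + n), v t < u t := by
    intro n
    induction n with
    | zero => simpa using he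
    | succ n ih =>
      intro t ht
      have ht2 := ht.2
      push_cast at ht2
      have hn : (0:ℝ) ≤ n := Nat.cast_nonneg n
      rcases le_total t (T + n) with h1 | h1
      · exact ih t ⟨ht.1, h1⟩
      have e0 : v (T + n) < u (T + n) := ih _ ⟨by linarith, le_rfl⟩
      have A := exp_mono_aux (k := a) (f := fun r => u r - v r)
        (g := fun r => b * (h (u (r - 1)) - h (v (r - 1)))) h1
        ((hu.cont.sub hv.cont).continuousOn) (by
          intro r hr
          refine ((hu r).sub (hv r)).congr_deriv ?_
          ring) (by
          intro r hr
          have e := ih (r - 1) ⟨by linarith [hr.1], by linarith [hr.2]⟩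
          have := hm e.le
          exact mul_nonneg hb.le (by linarith))
      have hp := exp_pos (a * t)
      have hp2 := exp_pos (a * (T + n))
      have : 0 < (u t - v t) * exp (a * t) := lt_of_lt_of_le (mul_pos (by linarith) hp2) A
      have := pos_of_mul_pos_left this hp.le
      linarith
  intro t ht
  obtain ⟨n, hn⟩ := exists_nat_ge (t - T)
  exact step n t ⟨by linarith, by linarith⟩

lemma exists_zero {a b : ℝ} {h u v : ℝ → ℝ} (hb : 0 < b) (hm : Monotone h)
    (hu : IsSolH a b h u) (hv : IsSolH a b h v) (h0 : u 0 = v 0) (T : ℝ) (hT : T ≤ 0) :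
    ∃ t ∈ Icc (T - 1) T, u t = v t := by
  by_contra! hne
  have hc : ContinuousOn (fun t => u t - v t) (Icc (T - 1) T) :=
    (hu.cont.sub hv.cont).continuousOn
  have key : ∀ w z : ℝ → ℝ, IsSolH a b h w → IsSolH a b h z → w 0 = z 0 →
      (∀ t ∈ Icc (T - 1) T, w t ≠ z t) → z T < w T → False := by
    intro w z hw hz h0 hne hlt
    have : ∀ t ∈ Icc (T - 1) T, z t < w t := by
      intro t ht
      by_contra! hcon
      have hc : ContinuousOn (fun t => w t - z t) (Icc t T) :=
        (hw.cont.sub hz.cont).continuousOn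
      have := intermediate_value_Icc ht.2 hc
      obtain ⟨r, hr, hr2⟩ := this (show (0:ℝ) ∈ _ from ⟨by simpa using hcon, by simpa using hlt.le⟩)
      exact hne r ⟨ht.1.trans hr.1, hr.2⟩ (by simpa [sub_eq_zero] using hr2)
    have := forward_order hb hm hw hz T this 0 hT
    linarith
  rcases lt_or_gt_of_ne (hne T ⟨by linarith, le_rfl⟩) with hl | hl
  · exact key v u hv hu h0.symm (fun t ht => (hne t ht).symm) hl
  · exact key u v hu hv h0 hne hl

/-- Harnack-type bound -/
lemma harnack {a b ξ B : ℝ} {h u : ℝ → ℝ} (H : CoreH_s5 a b ξ B h) (hu : IsSolH a b h u)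
    (T : ℝ) (hpos : ∀ t ≤ T, 0 ≤ u t) {s t : ℝ} (hst : s ≤ t) (ht : t ≤ T) :
    u s * exp (a * s) ≤ u t * exp (a * t) := by
  refine exp_mono_aux (k := a) (f := u) (g := fun r => b * h (u (r - 1))) hst
    hu.cont.continuousOn (fun r _ => hu r) ?_
  intro r hr
  have := H.mono (hpos (r - 1) (by linarith [hr.2]))
  rw [H.h0] at this
  exact mul_nonneg H.hb.le this

lemma inf_zero {a b ξ B κ : ℝ} {h u : ℝ → ℝ} (H : CoreH_s5 a b ξ B h) (hu : IsSolH a b h u)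
    (hκ : κ < ξ) (hr : ∀ t ≤ 0, u t ∈ Icc 0 κ) : ∀ ε > 0, ∃ t ≤ 0, u t < ε := by
  by_contra! hcon
  obtain ⟨ε, hε, hcon⟩ := hcon
  have ha := H.ha
  set S := sInf (u '' Iic 0) with hS
  have hbdd : BddBelow (u '' Iic 0) := ⟨0, by rintro _ ⟨t, ht, rfl⟩; exact (hr t ht).1⟩
  have hne : (u '' Iic 0).Nonempty := ⟨u 0, 0, by simp, rfl⟩
  have hSε : ε ≤ S := le_csInf hne (by rintro _ ⟨t, ht, rfl⟩; exact hcon t ht)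
  have hSu : ∀ t ≤ 0, S ≤ u t := fun t ht => csInf_le hbdd ⟨t, ht, rfl⟩
  have hSξ : S < ξ := lt_of_le_of_lt ((hSu 0 le_rfl).trans (hr 0 le_rfl).2) hκ
  have hp := H.pos S (by linarith) hSξ
  set c := b * h S / a with hc
  have hac : a * c = b * h S := by rw [hc]; field_simp
  have hcS : S < c := by
    by_contra! hh
    have := mul_le_mul_of_nonneg_left hh ha.le
    linarith
  have low : ∀ t ≤ 0, c ≤ u t := by
    intro t ht
    have A : ∀ s ≤ t, (u s - c) * exp (a * s) ≤ (u t - c) * exp (a * t) := by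
      intro s hs
      refine exp_mono_aux (k := a) (f := fun r => u r - c)
        (g := fun r => b * h (u (r - 1)) - b * h S) hs (hu.cont.sub continuous_const).continuousOn
        ?_ ?_
      · intro r _
        refine ((hu r).sub_const c).congr_deriv ?_
        rw [← hac]; ring
      · intro r hr'
        have := H.mono (hSu (r - 1) (by linarith [hr'.2]))
        have := mul_le_mul_of_nonneg_left this H.hb.le
        simpa using this
    have lim : Tendsto (fun s => -c * exp (a * s)) atBot (𝓝 (-c * 0)) := by
      apply Tendsto.const_mul
      exact tendsto_exp_atBot.comp (tendsto_id.const_mul_atBot ha)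
    have : -c * 0 ≤ (u t - c) * exp (a * t) := by
      refine le_of_tendsto lim ?_
      filter_upwards [eventually_le_atBot t] with s hs
      refine le_trans ?_ (A s hs)
      exact mul_le_mul_of_nonneg_right (by linarith [(hr s (hs.trans ht)).1]) (exp_pos _).le
    have := nonneg_of_mul_nonneg_left (by simpa using this) (exp_pos (a * t))
    linarith
  have : c ≤ S := le_csInf hne (by rintro _ ⟨t, ht, rfl⟩; exact low t ht)
  linarith

lemma forward_ge {a b ξ B : ℝ} {h u : ℝ → ℝ} (H : CoreH_s5 a b ξ B h) (hu : IsSolH a b h u)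
    (δ : ℝ) (hδ : 0 < δ) (hδξ : δ < ξ) (T : ℝ) (he : ∀ t ∈ Icc (T - 1) T, δ ≤ u t) :
    ∀ t, T ≤ t → δ ≤ u t := by
  have step : ∀ n : ℕ, ∀ t ∈ Icc (T - 1) (T + n), δ ≤ u t := by
    intro n
    induction n with
    | zero => simpa using he
    | succ n ih =>
      intro t ht
      have ht2 := ht.2
      push_cast at ht2
      have hn : (0:ℝ) ≤ n := Nat.cast_nonneg n
      rcases le_total t (T + n) with h1 | h1
      · exact ih t ⟨ht.1, h1⟩
      have e0 : δ ≤ u (T + n) := ih _ ⟨by linarith, le_rfl⟩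
      have A := exp_mono_aux (k := a) (f := fun r => u r - δ)
        (g := fun r => b * h (u (r - 1)) - a * δ) h1
        ((hu.cont.sub continuous_const).continuousOn) (by
          intro r hr
          refine ((hu r).sub_const δ).congr_deriv ?_
          ring) (by
          intro r hr
          have e := ih (r - 1) ⟨by linarith [hr.1], by linarith [hr.2]⟩
          have := mul_le_mul_of_nonneg_left (H.mono e) H.hb.le
          have := H.pos δ hδ hδξ
          linarith)
      have hp := exp_pos (a * t)
      have hp2 := exp_pos (a * (T + n))
      have : 0 ≤ (u t - δ) * exp (a * t) := le_trans (mul_nonneg (by linarith) hp2.le) A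
      have := nonneg_of_mul_nonneg_left this hp
      linarith
  intro t ht
  obtain ⟨n, hn⟩ := exists_nat_ge (t - T)
  exact step n t ⟨by linarith, by linarith⟩

lemma tendsto_zero {a b ξ B κ : ℝ} {h u : ℝ → ℝ} (H : CoreH_s5 a b ξ B h) (hu : IsSolH a b h u)
    (hκ : κ < ξ) (hr : ∀ t ≤ 0, u t ∈ Icc 0 κ) : Tendsto u atBot (𝓝 0) := by
  rw [Metric.tendsto_nhds]
  intro ε hε
  have ha := H.ha
  have hξ := H.hξ
  set δ := min (ε / 2 * exp (-a)) (ξ / 2) with hδ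
  have hδ0 : 0 < δ := lt_min (by positivity) (by positivity)
  have hδξ : δ < ξ := lt_of_le_of_lt (min_le_right _ _) (by linarith)
  obtain ⟨t1, ht1, ht1'⟩ := inf_zero H hu hκ hr δ hδ0
  filter_upwards [eventually_le_atBot (t1 - 1)] with r hr1
  have : ∃ t0 ∈ Icc r (r + 1), u t0 < δ := by
    by_contra! hcon
    have := forward_ge H hu δ hδ0 hδξ (r + 1) (by simpa using hcon) t1 (by linarith)
    linarith
  obtain ⟨t0, ht0, ht0'⟩ := this
  have A := harnack H hu 0 (fun t ht => (hr t ht).1) ht0.1 (by linarith [ht0.2])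
  have h1 : exp (a * t0) ≤ exp (a * r) * exp a := by
    rw [← exp_add]; apply exp_le_exp.2
    nlinarith [ht0.2]
  have hun : 0 ≤ u r := (hr r (by linarith)).1
  have hun0 : 0 ≤ u t0 := (hr t0 (by linarith [ht0.2])).1
  have h2 : u r * exp (a * r) ≤ (δ * exp a) * exp (a * r) := by
    calc u r * exp (a * r) ≤ u t0 * exp (a * t0) := A
      _ ≤ δ * (exp (a * r) * exp a) := mul_le_mul ht0'.le h1 (exp_pos _).le hδ0.le
      _ = _ := by ring
  have h3 : u r ≤ δ * exp a := le_of_mul_le_mul_right h2 (exp_pos _)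
  have h4 : δ * exp a ≤ ε / 2 := by
    calc δ * exp a ≤ (ε / 2 * exp (-a)) * exp a :=
          mul_le_mul_of_nonneg_right (min_le_left _ _) (exp_pos _).le
      _ = ε / 2 := by rw [mul_assoc, ← exp_add]; simp
  rw [Real.dist_eq, sub_zero, abs_of_nonneg hun]
  linarith

lemma growth {a b ξ B : ℝ} {h u : ℝ → ℝ} (H : CoreH_s5 a b ξ B h) (hu : IsSolH a b h u)
    (μ T : ℝ) (hk : 0 < μ + a) (hpos : ∀ t ≤ T, 0 ≤ u t)
    (hlow : ∀ t ≤ T, (μ + a) * exp μ * u t ≤ b * h (u t)) :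
    ∃ C, ∀ t ≤ T, u t ≤ C * exp (μ * t) := by
  set z : ℝ → ℝ := fun t => u t * exp (-μ * t) with hz
  have hexp : ∀ r : ℝ, HasDerivAt (fun r : ℝ => exp (-μ * r)) (exp (-μ * r) * -μ) r := by
    intro r
    simpa using ((hasDerivAt_id r).const_mul (-μ)).exp
  have hzc : Continuous z := hu.cont.mul (by fun_prop)
  have hzd : ∀ r, HasDerivAt z (-(μ + a) * z r + b * h (u (r - 1)) * exp (-μ * r)) r := by
    intro r
    refine ((hu r).mul (hexp r)).congr_deriv ?_
    simp only [hz]; ring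
  set Z : ℝ → ℝ := fun t => ∫ s in (0:ℝ)..t, z s with hZ
  have hZd : ∀ r, HasDerivAt Z (z r) r := fun r =>
    intervalIntegral.integral_hasDerivAt_right (hzc.intervalIntegrable _ _)
      hzc.aestronglyMeasurable.stronglyMeasurableAtFilter hzc.continuousAt
  have hZs : ∀ r, HasDerivAt (fun r => Z (r - 1)) (z (r - 1)) r := by
    intro r
    simpa using HasDerivAt.comp_sub_const r 1 (hZd (r - 1))
  set q : ℝ → ℝ := fun t => z t + (μ + a) * (Z t - Z (t - 1)) with hq
  have hqd : ∀ r, HasDerivAt q (b * h (u (r - 1)) * exp (-μ * r) - (μ + a) * z (r - 1)) r := by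
    intro r
    refine ((hzd r).add (((hZd r).sub (hZs r)).const_mul (μ + a))).congr_deriv ?_
    ring
  have hz0 : ∀ t ≤ T, 0 ≤ z t := fun t ht => mul_nonneg (hpos t ht) (exp_pos _).le
  have hZm : MonotoneOn Z (Iic T) := by
    apply monotoneOn_of_deriv_nonneg (convex_Iic T)
    · exact fun x _ => (hZd x).continuousAt.continuousWithinAt
    · exact fun x _ => (hZd x).differentiableAt.differentiableWithinAt
    · intro x hx
      rw [(hZd x).deriv]
      exact hz0 x (mem_Iic.1 (interior_subset hx))
  have hqm : MonotoneOn q (Iic T) := by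
    apply monotoneOn_of_deriv_nonneg (convex_Iic T)
    · exact fun x _ => (hqd x).continuousAt.continuousWithinAt
    · exact fun x _ => (hqd x).differentiableAt.differentiableWithinAt
    · intro x hx
      rw [(hqd x).deriv]
      have hx' : x ≤ T := mem_Iic.1 (interior_subset hx)
      have := mul_le_mul_of_nonneg_right (hlow (x - 1) (by linarith)) (exp_pos (-μ * x)).le
      have e : (μ + a) * exp μ * u (x - 1) * exp (-μ * x) = (μ + a) * z (x - 1) := by
        simp only [hz]
        have : exp (-μ * (x - 1)) = exp μ * exp (-μ * x) := by
          rw [← exp_add]; congr 1; ring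
        rw [this]; ring
      linarith
  refine ⟨q T, fun t ht => ?_⟩
  have h1 : z t ≤ q t := by
    have := hZm (show t - 1 ∈ Iic T by simp; linarith) (show t ∈ Iic T from ht) (by linarith)
    have := mul_nonneg hk.le (sub_nonneg.2 this)
    simp only [hq]; linarith
  have h2 : q t ≤ q T := hqm (show t ∈ Iic T from ht) (mem_Iic.2 le_rfl) ht
  have h3 : u t = z t * exp (μ * t) := by
    simp only [hz]; rw [mul_assoc, ← exp_add]; simp
  rw [h3]
  exact mul_le_mul_of_nonneg_right (h1.trans h2) (exp_pos _).le

/-- one-sided contraction step -/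
lemma contract_step {a b : ℝ} {h u v : ℝ → ℝ}
    (hu : IsSolH a b h u) (hv : IsSolH a b h v) (μ T q S : ℝ) (hk : 0 < μ + a) (hS : 0 ≤ S)
    (hq : 0 ≤ q)
    (hlip : ∀ t ≤ T, b * (h (u t) - h (v t)) ≤ q * |u t - v t|)
    (hb : ∀ t ≤ T, |u t - v t| ≤ S * exp (μ * t))
    (hz : ∀ t ≤ T, ∃ t0 ∈ Icc (t - 1) t, u t0 = v t0) :
    ∀ t ≤ T, u t - v t ≤ q * exp (-μ) * (1 - exp (-(μ + a))) / (μ + a) * S * exp (μ * t) := by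
  intro t ht
  obtain ⟨t0, ht0, he⟩ := hz t ht
  set σ := q * exp (-μ) / (μ + a) * S with hσ
  have hσ0 : 0 ≤ σ := by positivity
  have hexp : ∀ r : ℝ, HasDerivAt (fun r : ℝ => exp (-μ * r)) (exp (-μ * r) * -μ) r := by
    intro r
    simpa using ((hasDerivAt_id r).const_mul (-μ)).exp
  have A := exp_mono_aux (k := μ + a) (f := fun r => σ - (u r - v r) * exp (-μ * r))
    (g := fun r => (μ + a) * σ - b * (h (u (r - 1)) - h (v (r - 1))) * exp (-μ * r)) ht0.2
    (by
      apply Continuous.continuousOn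
      exact continuous_const.sub ((hu.cont.sub hv.cont).mul (by fun_prop)))
    (by
      intro r _
      refine ((((hu r).sub (hv r)).mul (hexp r)).const_sub σ).congr_deriv ?_
      simp only [Pi.sub_apply]
      ring)
    (by
      intro r hr
      have h1 := hlip (r - 1) (by linarith [hr.2])
      have h2 := mul_le_mul_of_nonneg_left (hb (r - 1) (by linarith [hr.2])) hq
      have h3 := mul_le_mul_of_nonneg_right (h1.trans h2) (exp_pos (-μ * r)).le
      have e1 : q * (S * exp (μ * (r - 1))) * exp (-μ * r) = (μ + a) * σ := by
        have : exp (μ * (r - 1)) * exp (-μ * r) = exp (-μ) := by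
          rw [← exp_add]; congr 1; ring
        rw [hσ]
        field_simp
        rw [← this]
        ring_nf
      linarith)
  simp only [he, sub_self, zero_mul, sub_zero] at A
  set z := (u t - v t) * exp (-μ * t) with hzdef
  have h4 : exp ((μ + a) * t) * exp (-(μ + a)) ≤ exp ((μ + a) * t0) := by
    rw [← exp_add]; apply exp_le_exp.2; nlinarith [ht0.1]
  have h5 : σ * exp (-(μ + a)) * exp ((μ + a) * t) ≤ (σ - z) * exp ((μ + a) * t) := by
    have := mul_le_mul_of_nonneg_left h4 hσ0
    linarith
  have h6 := le_of_mul_le_mul_right h5 (exp_pos _)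
  have h7 : u t - v t = z * exp (μ * t) := by
    rw [hzdef, mul_assoc, ← exp_add]; simp
  rw [h7]
  apply mul_le_mul_of_nonneg_right _ (exp_pos _).le
  have : q * exp (-μ) * (1 - exp (-(μ + a))) / (μ + a) * S = σ - σ * exp (-(μ + a)) := by
    rw [hσ]; ring
  linarith

lemma exists_mu {a B : ℝ} (ha : 0 < a) (hB : a < B) :
    ∃ μ q : ℝ, 0 < μ + a ∧ (μ + a) * exp μ < B ∧ B < q ∧
      q * (1 - exp (-(μ + a))) < (μ + a) * exp μ := by
  have hB0 : 0 < B := ha.trans hB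
  have h1 : max a (B * (1 - exp (-(B + a)))) < B := by
    apply max_lt hB
    nlinarith [exp_pos (-(B + a))]
  obtain ⟨y, hy1, hy2⟩ := exists_between h1
  have hya : a < y := lt_of_le_of_lt (le_max_left _ _) hy1
  have hyb : B * (1 - exp (-(B + a))) < y := lt_of_le_of_lt (le_max_right _ _) hy1
  have hc : ContinuousOn (fun μ : ℝ => (μ + a) * exp μ) (Icc 0 B) := by fun_prop
  obtain ⟨μ, hμ, hμy⟩ := intermediate_value_Icc hB0.le hc (show y ∈ _ from ⟨by simpa using hya.le, by
    have : 1 ≤ exp B := one_le_exp hB0.le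
    nlinarith⟩)
  simp only at hμy
  have hk : 0 < μ + a := by linarith [hμ.1]
  have hr : 0 < 1 - exp (-(μ + a)) := by
    have : exp (-(μ + a)) < 1 := by rw [← exp_zero]; exact exp_lt_exp.2 (by linarith)
    linarith
  have h2 : B * (1 - exp (-(μ + a))) < y := by
    refine lt_of_le_of_lt ?_ hyb
    apply mul_le_mul_of_nonneg_left _ hB0.le
    have : exp (-(B + a)) ≤ exp (-(μ + a)) := exp_le_exp.2 (by linarith [hμ.2])
    linarith
  obtain ⟨q, hq1, hq2⟩ := exists_between ((lt_div_iff₀ hr).2 h2)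
  exact ⟨μ, q, hk, by rw [hμy]; exact hy2, hq1, by rw [hμy]; exact (lt_div_iff₀ hr).1 hq2⟩

lemma past_unique {a b ξ B κ : ℝ} {h u v : ℝ → ℝ} (H : CoreH_s5 a b ξ B h)
    (hu : IsSolH a b h u) (hv : IsSolH a b h v) (hκ : κ < ξ)
    (hur : ∀ t ≤ 0, u t ∈ Icc 0 κ) (hvr : ∀ t ≤ 0, v t ∈ Icc 0 κ) (h0 : u 0 = v 0) : u = v := by
  obtain ⟨μ, q, hk, hμB, hBq, hq⟩ := exists_mu H.ha H.hB
  obtain ⟨x0, hx0, hx⟩ := H.near _ _ hμB hBq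
  have small : ∀ w : ℝ → ℝ, IsSolH a b h w → (∀ t ≤ 0, w t ∈ Icc 0 κ) →
      ∀ᶠ t in atBot, |w t| ≤ x0 := by
    intro w hw hwr
    have := tendsto_zero H hw hκ hwr
    rw [Metric.tendsto_nhds] at this
    filter_upwards [this x0 hx0] with t ht
    rw [Real.dist_eq, sub_zero] at ht
    exact ht.le
  obtain ⟨T, hT⟩ := eventually_atBot.1 (((small u hu hur).and (small v hv hvr)).and
    (eventually_le_atBot (0:ℝ)))
  have hT0 : T ≤ 0 := (hT T le_rfl).2
  have low : ∀ w : ℝ → ℝ, (∀ t ≤ 0, w t ∈ Icc 0 κ) → (∀ t ≤ T, |w t| ≤ x0) →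
      ∀ t ≤ T, (μ + a) * exp μ * w t ≤ b * h (w t) := by
    intro w hwr hw t ht
    have := (hx 0 (w t) (by simpa using hx0.le) (hw t ht) (hwr t (ht.trans hT0)).1).1
    simpa [H.h0] using this
  obtain ⟨C1, hC1⟩ := growth H hu μ T hk (fun t ht => (hur t (ht.trans hT0)).1)
    (low u hur fun t ht => (hT t ht).1.1)
  obtain ⟨C2, hC2⟩ := growth H hv μ T hk (fun t ht => (hvr t (ht.trans hT0)).1)
    (low v hvr fun t ht => (hT t ht).1.2)
  have hq0 : 0 ≤ q := by linarith [H.ha, H.hB]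
  have lip : ∀ t ≤ T, |b * (h (u t) - h (v t))| ≤ q * |u t - v t| := by
    intro t ht
    have hb := H.hb
    rcases le_total (u t) (v t) with hle | hle
    · have := (hx (u t) (v t) (hT t ht).1.1 (hT t ht).1.2 hle).2
      rw [abs_sub_comm (u t), abs_of_nonneg (sub_nonneg.2 hle), abs_mul, abs_sub_comm (h (u t)),
        abs_of_nonneg (sub_nonneg.2 (H.mono hle)), abs_of_pos hb]
      exact this
    · have := (hx (v t) (u t) (hT t ht).1.2 (hT t ht).1.1 hle).2
      rw [abs_of_nonneg (sub_nonneg.2 hle), abs_mul,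
        abs_of_nonneg (sub_nonneg.2 (H.mono hle)), abs_of_pos hb]
      exact this
  have hz : ∀ t ≤ T, ∃ t0 ∈ Icc (t - 1) t, u t0 = v t0 := fun t ht =>
    exists_zero H.hb H.mono hu hv h0 t (ht.trans hT0)
  set θ := q * exp (-μ) * (1 - exp (-(μ + a))) / (μ + a) with hθ
  have hr : 0 ≤ 1 - exp (-(μ + a)) := by
    have : exp (-(μ + a)) < 1 := by rw [← exp_zero]; exact exp_lt_exp.2 (by linarith)
    linarith
  have hθ0 : 0 ≤ θ := by positivity
  have hθ1 : θ < 1 := by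
    rw [hθ, div_lt_one hk]
    have := mul_lt_mul_of_pos_right hq (exp_pos (-μ))
    have e : (μ + a) * exp μ * exp (-μ) = μ + a := by rw [mul_assoc, ← exp_add]; simp
    linarith
  have hC0 : 0 ≤ max C1 C2 := by
    have h1 := (hur T hT0).1.trans (hC1 T le_rfl)
    exact (nonneg_of_mul_nonneg_left h1 (exp_pos _)).trans (le_max_left _ _)
  have iter : ∀ n : ℕ, ∀ t ≤ T, |u t - v t| ≤ θ ^ n * max C1 C2 * exp (μ * t) := by
    intro n
    induction n with
    | zero =>
      intro t ht
      have h1 := hC1 t ht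
      have h2 := hC2 t ht
      have h3 := mul_le_mul_of_nonneg_right (le_max_left C1 C2) (exp_pos (μ * t)).le
      have h4 := mul_le_mul_of_nonneg_right (le_max_right C1 C2) (exp_pos (μ * t)).le
      have h5 := (hur t (ht.trans hT0)).1
      have h6 := (hvr t (ht.trans hT0)).1
      rw [pow_zero, one_mul, abs_le]
      constructor <;> linarith
    | succ n ih =>
      intro t ht
      have hS : 0 ≤ θ ^ n * max C1 C2 := by positivity
      have A := contract_step hu hv μ T q _ hk hS hq0
        (fun t ht => (le_abs_self _).trans (lip t ht)) ih hz t ht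
      have A' := contract_step hv hu μ T q _ hk hS hq0
        (fun t ht => by
          rw [abs_sub_comm]
          refine le_trans ?_ (lip t ht)
          rw [← abs_neg]
          refine le_trans (le_of_eq ?_) (le_abs_self _)
          ring) (fun t ht => by rw [abs_sub_comm]; exact ih t ht)
          (fun t ht => (hz t ht).imp fun _ h => ⟨h.1, h.2.symm⟩) t ht
      rw [← hθ] at A A'
      have e : θ ^ (n + 1) * max C1 C2 = θ * (θ ^ n * max C1 C2) := by ring
      rw [e, abs_le]
      constructor <;> linarith
  refine forward_unique hu hv T fun t ht => ?_
  have lim : Tendsto (fun n : ℕ => θ ^ n * max C1 C2 * exp (μ * t)) atTop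
      (𝓝 (0 * max C1 C2 * exp (μ * t))) :=
    ((tendsto_pow_atTop_nhds_zero_of_lt_one hθ0 hθ1).mul_const _).mul_const _
  have := ge_of_tendsto' lim (fun n => iter n t ht)
  simp only [zero_mul] at this
  have := abs_nonpos_iff.1 this
  linarith

/-- auxiliary variation-of-constants function -/
def Xop (a b m : ℝ) (h v : ℝ → ℝ) (t : ℝ) : ℝ :=
  exp (-a * t) * (m + ∫ s in (0:ℝ)..t, exp (a * s) * (b * h (v (s - 1))))

def Gop (a b m : ℝ) (h v : ℝ → ℝ) (t : ℝ) : ℝ := Xop a b m h v (max t 0)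

def Vit (a b m : ℝ) (h : ℝ → ℝ) : ℕ → ℝ → ℝ
  | 0 => fun _ => m
  | k + 1 => Gop a b m h (Vit a b m h k)

lemma Xop_deriv {a b m : ℝ} {h v : ℝ → ℝ} (hh : Continuous h) (hv : Continuous v) (t : ℝ) :
    HasDerivAt (Xop a b m h v) (-a * Xop a b m h v t + b * h (v (t - 1))) t := by
  have hF : Continuous (fun s => exp (a * s) * (b * h (v (s - 1)))) := by fun_prop
  have h1 : HasDerivAt (fun t => ∫ s in (0:ℝ)..t, exp (a * s) * (b * h (v (s - 1))))
      (exp (a * t) * (b * h (v (t - 1)))) t :=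
    intervalIntegral.integral_hasDerivAt_right (hF.intervalIntegrable _ _)
      hF.aestronglyMeasurable.stronglyMeasurableAtFilter hF.continuousAt
  have h2 : HasDerivAt (fun r : ℝ => exp (-a * r)) (exp (-a * t) * -a) t := by
    simpa using ((hasDerivAt_id t).const_mul (-a)).exp
  refine (h2.mul (h1.const_add m)).congr_deriv ?_
  have e : exp (-a * t) * exp (a * t) = 1 := by rw [← exp_add]; simp
  simp only [Xop]
  linear_combination (b * h (v (t - 1))) * e

lemma Xop_zero {a b m : ℝ} {h v : ℝ → ℝ} : Xop a b m h v 0 = m := by simp [Xop]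

lemma Gop_good {a b m ξ B : ℝ} {h v : ℝ → ℝ} (H : CoreH_s5 a b ξ B h) (hm : a * m ≤ b * h m)
    (hc : Continuous v) (hv : Monotone v) (hr : ∀ t, v t ∈ Icc m ξ) :
    Continuous (Gop a b m h v) ∧ Monotone (Gop a b m h v) ∧ ∀ t, Gop a b m h v t ∈ Icc m ξ := by
  have ha := H.ha
  have hb := H.hb
  have hd := Xop_deriv (a := a) (b := b) (m := m) H.cont hc
  have hXc : Continuous (Xop a b m h v) :=
    continuous_iff_continuousAt.2 fun t => (hd t).continuousAt
  have up : ∀ t, 0 ≤ t → a * Xop a b m h v t ≤ b * h (v (t - 1)) := by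
    intro t ht
    set c := b * h (v (t - 1)) / a with hcdef
    have hac : a * c = b * h (v (t - 1)) := by rw [hcdef]; field_simp
    have hcm : m ≤ c := by
      have := mul_le_mul_of_nonneg_left (H.mono (hr (t - 1)).1) hb.le
      refine le_of_mul_le_mul_left ?_ ha
      linarith
    have A := exp_mono_aux (k := a) (f := fun r => c - Xop a b m h v r)
      (g := fun r => b * h (v (t - 1)) - b * h (v (r - 1))) ht
      (continuous_const.sub hXc).continuousOn
      (by
        intro r _
        refine ((hd r).const_sub c).congr_deriv ?_
        rw [← hac]; ring)
      (by
        intro r hr'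
        have := mul_le_mul_of_nonneg_left
          (H.mono (hv (show r - 1 ≤ t - 1 by linarith [hr'.2]))) hb.le
        linarith)
    simp only [Xop_zero, mul_zero, exp_zero, mul_one] at A
    have : 0 ≤ (c - Xop a b m h v t) * exp (a * t) := by linarith
    have := nonneg_of_mul_nonneg_left this (exp_pos _)
    nlinarith
  have hXm : MonotoneOn (Xop a b m h v) (Ici 0) := by
    apply monotoneOn_of_deriv_nonneg (convex_Ici 0) hXc.continuousOn
    · exact fun x _ => (hd x).differentiableAt.differentiableWithinAt
    · intro x hx
      rw [(hd x).deriv]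
      have := up x (mem_Ici.1 (interior_subset hx))
      linarith
  have hmono : Monotone (Gop a b m h v) := by
    intro s t hst
    exact hXm (mem_Ici.2 (le_max_right _ _)) (mem_Ici.2 (le_max_right _ _))
      (max_le_max hst le_rfl)
  refine ⟨hXc.comp (by fun_prop), hmono, fun t => ⟨?_, ?_⟩⟩
  · have := hXm (mem_Ici.2 le_rfl) (mem_Ici.2 (le_max_right t 0)) (le_max_right t 0)
    rwa [Xop_zero] at this
  · have h1 := up (max t 0) (le_max_right _ _)
    have h2 := mul_le_mul_of_nonneg_left (H.mono (hr (max t 0 - 1)).2) hb.le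
    rw [H.zero] at h2
    exact le_of_mul_le_mul_left (h1.trans h2) ha

lemma Vit_good {a b m ξ B : ℝ} {h : ℝ → ℝ} (H : CoreH_s5 a b ξ B h) (hm : a * m ≤ b * h m)
    (hmξ : m ≤ ξ) (k : ℕ) : Continuous (Vit a b m h k) ∧ Monotone (Vit a b m h k) ∧
      ∀ t, Vit a b m h k t ∈ Icc m ξ := by
  induction k with
  | zero => exact ⟨continuous_const, monotone_const, fun t => ⟨le_rfl, hmξ⟩⟩
  | succ k ih => exact Gop_good H hm ih.1 ih.2.1 ih.2.2

lemma Vit_succ {a b m : ℝ} {h : ℝ → ℝ} (k : ℕ) : ∀ t ≤ (k:ℝ),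
    Vit a b m h (k + 1) t = Vit a b m h k t := by
  induction k with
  | zero =>
    intro t ht
    have : max t 0 = 0 := max_eq_right (by simpa using ht)
    simp [Vit, Gop, this, Xop_zero]
  | succ k ih =>
    intro t ht
    change Gop a b m h (Vit a b m h (k + 1)) t = Gop a b m h (Vit a b m h k) t
    simp only [Gop, Xop]
    congr 2
    apply intervalIntegral.integral_congr
    intro s hs
    rw [uIcc_of_le (le_max_right _ _)] at hs
    have : s ≤ k + 1 := hs.2.trans (max_le (by exact_mod_cast ht) (by positivity))
    simp only
    rw [ih (s - 1) (by linarith)]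

lemma Vit_eq {a b m : ℝ} {h : ℝ → ℝ} {j k : ℕ} (hjk : j ≤ k) (t : ℝ) (ht : t ≤ (j:ℝ)) :
    Vit a b m h k t = Vit a b m h j t := by
  induction k, hjk using Nat.le_induction with
  | base => rfl
  | succ k hk ih =>
    rw [Vit_succ k t (ht.trans (by exact_mod_cast hk)), ih]

lemma exists_fwd {a b m ξ B : ℝ} {h : ℝ → ℝ} (H : CoreH_s5 a b ξ B h) (hm : a * m ≤ b * h m)
    (hmξ : m ≤ ξ) : ∃ v : ℝ → ℝ, Continuous v ∧ Monotone v ∧ (∀ t, v t ∈ Icc m ξ) ∧ v 0 = m ∧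
      ∀ t > 0, HasDerivAt v (-a * v t + b * h (v (t - 1))) t := by
  set v : ℝ → ℝ := fun t => Vit a b m h ⌈t⌉₊ t with hv
  have ev : ∀ (k : ℕ) (t : ℝ), t ≤ k → v t = Vit a b m h k t := by
    intro k t ht
    exact (Vit_eq (Nat.ceil_le.2 ht) t (Nat.le_ceil t)).symm
  have evn : ∀ t : ℝ, ∀ᶠ s in 𝓝 t, v s = Vit a b m h (⌈t⌉₊ + 2) s := by
    intro t
    filter_upwards [Iio_mem_nhds (show t < t + 1 by linarith)] with s hs
    apply ev
    have := Nat.le_ceil t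
    push_cast
    have := mem_Iio.1 hs
    linarith
  have G := fun k => Vit_good H hm hmξ k
  refine ⟨v, ?_, ?_, fun t => (G _).2.2 t, ?_, ?_⟩
  · rw [continuous_iff_continuousAt]
    intro t
    exact (G _).1.continuousAt.congr ((evn t).mono fun _ h => h.symm)
  · intro s t hst
    rw [ev ⌈t⌉₊ s (hst.trans (Nat.le_ceil t)), ev ⌈t⌉₊ t (Nat.le_ceil t)]
    exact (G _).2.1 hst
  · simp [hv, Vit]
  · intro t ht
    have e1 : v t = Vit a b m h (⌈t⌉₊ + 2) t := (evn t).self_of_nhds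
    have e2 : v (t - 1) = Vit a b m h (⌈t⌉₊ + 1) (t - 1) := by
      apply ev
      have := Nat.le_ceil t
      push_cast
      linarith
    rw [e1, e2]
    refine HasDerivAt.congr_of_eventuallyEq ?_ (evn t)
    have hd := Xop_deriv (a := a) (b := b) (m := m) H.cont (G (⌈t⌉₊ + 1)).1 t
    have e3 : ∀ s > 0, Vit a b m h (⌈t⌉₊ + 2) s = Xop a b m h (Vit a b m h (⌈t⌉₊ + 1)) s := by
      intro s hs
      change Gop a b m h (Vit a b m h (⌈t⌉₊ + 1)) s = _
      rw [Gop, max_eq_left (le_of_lt hs)]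
    rw [e3 t ht]
    refine hd.congr_of_eventuallyEq ?_
    filter_upwards [Ioi_mem_nhds ht] with s hs
    exact e3 s hs

lemma lim_deriv_zero {f f' : ℝ → ℝ} {T L D : ℝ} (hf : Tendsto f atTop (𝓝 L))
    (hd : ∀ t > T, HasDerivAt f (f' t) t) (hf' : Tendsto f' atTop (𝓝 D)) : D = 0 := by
  have hc : ∀ t : ℝ, ∃ c, t ≤ c ∧ (T < t → f' c = f (t + 1) - f t) := by
    intro t
    by_cases ht : T < t
    · obtain ⟨c, hc, hc2⟩ := exists_hasDerivAt_eq_slope f f' (show t < t + 1 by linarith)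
        (fun x hx => (hd x (by linarith [hx.1])).continuousAt.continuousWithinAt)
        (fun x hx => hd x (by linarith [hx.1]))
      exact ⟨c, hc.1.le, fun _ => by rw [hc2]; simp⟩
    · exact ⟨t, le_rfl, fun h => absurd h ht⟩
  choose c hc1 hc2 using hc
  have h1 : Tendsto (fun t => f' (c t)) atTop (𝓝 D) :=
    hf'.comp (tendsto_atTop_mono hc1 tendsto_id)
  have h2 : Tendsto (fun t => f (t + 1) - f t) atTop (𝓝 (L - L)) :=
    (hf.comp (tendsto_atTop_add_const_right _ 1 tendsto_id)).sub hf
  have h3 : Tendsto (fun t => f' (c t)) atTop (𝓝 (L - L)) := by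
    refine h2.congr' ?_
    filter_upwards [eventually_gt_atTop T] with t ht
    exact (hc2 t ht).symm
  simpa using tendsto_nhds_unique h1 h3

lemma tendsto_top {a b ξ B T T' : ℝ} {h v : ℝ → ℝ} (H : CoreH_s5 a b ξ B h)
    (hv : Monotone v) (hr : ∀ t, v t ≤ ξ) (hp : 0 < v T')
    (hd : ∀ t > T, HasDerivAt v (-a * v t + b * h (v (t - 1))) t) : Tendsto v atTop (𝓝 ξ) := by
  have hbdd : BddAbove (range v) := ⟨ξ, by rintro _ ⟨t, rfl⟩; exact hr t⟩
  have hL := tendsto_atTop_ciSup hv hbdd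
  set L := ⨆ t, v t
  have h1 : v T' ≤ L := le_ciSup hbdd T'
  have h2 : L ≤ ξ := ciSup_le hr
  have h3 : Tendsto (fun t => v (t - 1)) atTop (𝓝 L) :=
    hL.comp (tendsto_atTop_add_const_right _ (-1) tendsto_id)
  have h4 : Tendsto (fun t => -a * v t + b * h (v (t - 1))) atTop (𝓝 (-a * L + b * h L)) :=
    (hL.const_mul _).add (((H.cont.tendsto L).comp h3).const_mul b)
  have h5 := lim_deriv_zero hL hd h4
  rcases h2.lt_or_eq with h6 | h6
  · have := H.pos L (by linarith) h6
    linarith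
  · rwa [← h6]

lemma lin_bound {a b ξ B : ℝ} {h : ℝ → ℝ} (H : CoreH_s5 a b ξ B h) :
    ∃ L > 0, ∀ x ∈ Icc 0 ξ, b * h x ≤ L * x := by
  obtain ⟨x0, hx0, hx⟩ := H.near (B - 1) (B + 1) (by linarith) (by linarith)
  have ha := H.ha
  have hB := H.hB
  refine ⟨max (B + 1) (a * ξ / x0), lt_max_of_lt_left (by linarith), fun x hx' => ?_⟩
  rcases le_total x x0 with hle | hle
  · have := (hx 0 x (by simpa using hx0.le) (by rw [abs_of_nonneg hx'.1]; exact hle) hx'.1).2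
    simp only [H.h0, sub_zero] at this
    exact this.trans (mul_le_mul_of_nonneg_right (le_max_left _ _) hx'.1)
  · have h1 := mul_le_mul_of_nonneg_left (H.mono hx'.2) H.hb.le
    rw [H.zero] at h1
    have h2 : a * ξ = a * ξ / x0 * x0 := by field_simp
    have h3 : a * ξ / x0 * x0 ≤ a * ξ / x0 * x := mul_le_mul_of_nonneg_left hle
      (by have := H.hξ; positivity)
    have h4 := mul_le_mul_of_nonneg_right (le_max_right (B + 1) (a * ξ / x0)) hx'.1
    linarith

lemma approx {a b ξ B κ L m : ℝ} {h : ℝ → ℝ} (H : CoreH_s5 a b ξ B h) (hκ : κ < ξ)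
    (hm0 : 0 < m) (hmκ : m < κ) (hL : ∀ x ∈ Icc 0 ξ, b * h x ≤ L * x) (hL0 : 0 < L) :
    ∃ (u : ℝ → ℝ) (τ : ℝ), κ ≤ m * exp (L * τ) ∧ Monotone u ∧ (∀ t, u t ∈ Icc 0 ξ) ∧ u 0 = κ ∧
      ∀ t > -τ, HasDerivAt u (-a * u t + b * h (u (t - 1))) t := by
  obtain ⟨v, hvc, hvm, hvr, hv0, hvd⟩ := exists_fwd H (H.pos m hm0 (by linarith)).le
    (show m ≤ ξ by linarith)
  have hlim := tendsto_top (T' := 0) H hvm (fun t => (hvr t).2) (by rw [hv0]; exact hm0) hvd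
  obtain ⟨t1, ht1, ht1'⟩ := ((hlim.eventually (lt_mem_nhds hκ)).and (eventually_ge_atTop 0)).exists
  obtain ⟨τ, hτ, hτκ⟩ := intermediate_value_Icc ht1' hvc.continuousOn
    (show κ ∈ _ from ⟨by rw [hv0]; exact hmκ.le, ht1.le⟩)
  refine ⟨fun t => v (t + τ), τ, ?_, fun s t hst => hvm (by linarith), fun t =>
    ⟨hm0.le.trans (hvr _).1, (hvr _).2⟩, by simpa using hτκ, ?_⟩
  · have A := exp_mono_aux (k := -L) (f := fun r => -v r)
      (g := fun r => a * v r - b * h (v (r - 1)) + L * v r) hτ.1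
      hvc.neg.continuousOn
      (by
        intro r hr
        refine (hvd r hr.1).neg.congr_deriv ?_
        ring)
      (by
        intro r hr
        have h1 := hL (v (r - 1)) ⟨hm0.le.trans (hvr _).1, (hvr _).2⟩
        have h2 := mul_le_mul_of_nonneg_left (hvm (show r - 1 ≤ r by linarith)) hL0.le
        have h3 := mul_nonneg H.ha.le (hm0.le.trans (hvr r).1)
        linarith)
    simp only [hv0, mul_zero, exp_zero, mul_one, hτκ] at A
    have e : exp (-L * τ) * exp (L * τ) = 1 := by rw [← exp_add]; simp
    have : κ * exp (-L * τ) * exp (L * τ) ≤ m * exp (L * τ) :=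
      mul_le_mul_of_nonneg_right (by linarith) (exp_pos _).le
    rwa [mul_assoc, e, mul_one] at this
  · intro t ht
    have := HasDerivAt.comp_add_const t τ (hvd (t + τ) (by linarith))
    have e : t - 1 + τ = t + τ - 1 := by ring
    simp only [e]
    exact this

/-- two-sided mean value inequalities for a monotone solution -/
lemma mvt_ineq {a b ξ B T : ℝ} {h u : ℝ → ℝ} (H : CoreH_s5 a b ξ B h) (hm : Monotone u)
    (hd : ∀ t > T, HasDerivAt u (-a * u t + b * h (u (t - 1))) t) {s t : ℝ} (hs : T < s)
    (hst : s < t) : (t - s) * (-a * u t + b * h (u (s - 1))) ≤ u t - u s ∧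
      u t - u s ≤ (t - s) * (-a * u s + b * h (u (t - 1))) := by
  obtain ⟨c, hc, hc2⟩ := exists_hasDerivAt_eq_slope u _ hst
    (fun x hx => (hd x (by linarith [hx.1])).continuousAt.continuousWithinAt)
    (fun x hx => hd x (by linarith [hx.1]))
  have hts : 0 < t - s := by linarith
  rw [eq_div_iff hts.ne', mul_comm] at hc2
  rw [← hc2]
  have h1 := mul_le_mul_of_nonneg_left (hm hc.1.le) H.ha.le
  have h2 := mul_le_mul_of_nonneg_left (hm hc.2.le) H.ha.le
  have h3 := mul_le_mul_of_nonneg_left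
    (H.mono (hm (show s - 1 ≤ c - 1 by linarith [hc.1]))) H.hb.le
  have h4 := mul_le_mul_of_nonneg_left
    (H.mono (hm (show c - 1 ≤ t - 1 by linarith [hc.2]))) H.hb.le
  constructor <;> exact mul_le_mul_of_nonneg_left (by linarith) hts.le

lemma sol_of_ineq {a b ξ B : ℝ} {h u : ℝ → ℝ} (H : CoreH_s5 a b ξ B h) (hm : Monotone u)
    (hr : ∀ t, u t ∈ Icc 0 ξ)
    (hi : ∀ s t, s < t → (t - s) * (-a * u t + b * h (u (s - 1))) ≤ u t - u s ∧
      u t - u s ≤ (t - s) * (-a * u s + b * h (u (t - 1)))) : IsSolH a b h u := by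
  have ha := H.ha
  have hξ := H.hξ
  have lip : ∀ s t, s ≤ t → u t - u s ≤ a * ξ * (t - s) := by
    intro s t hst
    rcases hst.eq_or_lt with rfl | hst
    · simp
    refine (hi s t hst).2.trans ?_
    rw [mul_comm]
    apply mul_le_mul_of_nonneg_right _ (by linarith)
    have h1 := mul_le_mul_of_nonneg_left (H.mono (hr (t - 1)).2) H.hb.le
    rw [H.zero] at h1
    have h2 := mul_nonneg ha.le (hr s).1
    linarith
  have hc : Continuous u := by
    have : LipschitzWith (Real.toNNReal (a * ξ)) u := by
      apply LipschitzWith.of_dist_le_mul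
      intro x y
      rw [Real.coe_toNNReal _ (by positivity), Real.dist_eq, Real.dist_eq]
      rcases le_total x y with hxy | hxy
      · rw [abs_sub_comm, abs_of_nonneg (sub_nonneg.2 (hm hxy)), abs_sub_comm,
          abs_of_nonneg (sub_nonneg.2 hxy)]
        exact lip x y hxy
      · rw [abs_of_nonneg (sub_nonneg.2 (hm hxy)),
          abs_of_nonneg (sub_nonneg.2 hxy)]
        exact lip y x hxy
    exact this.continuous
  intro x
  rw [hasDerivAt_iff_tendsto_slope]
  set P : ℝ → ℝ := fun y => -a * u y + b * h (u (x - 1)) with hP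
  set Q : ℝ → ℝ := fun y => -a * u x + b * h (u (y - 1)) with hQ
  have hh := H.cont
  have hPc : Continuous P := by fun_prop
  have hQc : Continuous Q := by fun_prop
  have hPt : Tendsto P (𝓝[≠] x) (𝓝 (-a * u x + b * h (u (x - 1)))) :=
    (hPc.tendsto x).mono_left nhdsWithin_le_nhds
  have hQt : Tendsto Q (𝓝[≠] x) (𝓝 (-a * u x + b * h (u (x - 1)))) :=
    (hQc.tendsto x).mono_left nhdsWithin_le_nhds
  have hmin := hPt.min hQt
  have hmax := hPt.max hQt
  rw [min_self] at hmin
  rw [max_self] at hmax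
  have key : ∀ y, y ≠ x → min (P y) (Q y) ≤ slope u x y ∧ slope u x y ≤ max (P y) (Q y) := by
    intro y hy
    rcases lt_or_gt_of_ne hy with hlt | hlt
    · have := hi y x hlt
      have hp : 0 < x - y := by linarith
      rw [slope_comm, slope_def_field]
      constructor
      · refine (min_le_right _ _).trans ?_
        rw [le_div_iff₀ hp, mul_comm]; exact this.1
      · refine le_trans ?_ (le_max_left _ _)
        rw [div_le_iff₀ hp, mul_comm]; exact this.2
    · have := hi x y hlt
      have hp : 0 < y - x := by linarith
      rw [slope_def_field]
      constructor
      · refine (min_le_left _ _).trans ?_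
        rw [le_div_iff₀ hp, mul_comm]; exact this.1
      · refine le_trans ?_ (le_max_right _ _)
        rw [div_le_iff₀ hp, mul_comm]; exact this.2
  refine tendsto_of_tendsto_of_tendsto_of_le_of_le' hmin hmax ?_ ?_
  · filter_upwards [self_mem_nhdsWithin] with y hy using (key y hy).1
  · filter_upwards [self_mem_nhdsWithin] with y hy using (key y hy).2

lemma exists_sol {a b ξ B κ : ℝ} {h : ℝ → ℝ} (H : CoreH_s5 a b ξ B h) (hκ0 : 0 < κ) (hκ : κ < ξ) :
    ∃ u : ℝ → ℝ, IsSolH a b h u ∧ Monotone u ∧ (∀ t, u t ∈ Icc 0 ξ) ∧ u 0 = κ := by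
  obtain ⟨L, hL0, hL⟩ := lin_bound H
  have hex : ∀ n : ℕ, _ := fun n => approx (m := κ / (n + 2)) H hκ (by positivity)
    (by rw [div_lt_iff₀ (by positivity)]; nlinarith [Nat.cast_nonneg (α := ℝ) n]) hL hL0
  choose w τ hτ hwm hwr hw0 hwd using hex
  set U : Ultrafilter ℕ := hyperfilter ℕ with hU
  have hUle : (U : Filter ℕ) ≤ atTop := by
    rw [hU, ← Nat.cofinite_eq_atTop]; exact hyperfilter_le_cofinite
  have hlim : ∀ t, ∃ y ∈ Icc 0 ξ, Tendsto (fun n => w n t) U (𝓝 y) := by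
    intro t
    obtain ⟨y, hy, hy2⟩ := isCompact_Icc.ultrafilter_le_nhds (U.map fun n => w n t) (by
      rw [le_principal_iff]
      exact Filter.mem_map.2 (univ_mem' fun n => hwr n t))
    exact ⟨y, hy, hy2⟩
  choose u hur hut using hlim
  have hum : Monotone u := fun s t hst =>
    le_of_tendsto_of_tendsto' (hut s) (hut t) fun n => hwm n hst
  have hτt : ∀ s : ℝ, ∀ᶠ n in (U : Filter ℕ), -τ n < s := by
    intro s
    apply hUle
    filter_upwards [(tendsto_natCast_atTop_atTop (R := ℝ)).eventually_gt_atTop (exp (L * (-s)))]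
      with n hn
    have h1 := hτ n
    have hn2 : (0:ℝ) < n + 2 := by positivity
    rw [div_mul_eq_mul_div, le_div_iff₀ hn2] at h1
    have h2 : (n:ℝ) + 2 ≤ exp (L * τ n) := le_of_mul_le_mul_left h1 hκ0
    have h3 : exp (L * (-s)) < exp (L * τ n) := by linarith
    have h4 := exp_lt_exp.1 h3
    have := lt_of_mul_lt_mul_left h4 hL0.le
    linarith
  refine ⟨u, sol_of_ineq H hum hur ?_, hum, hur, ?_⟩
  · intro s t hst
    have hh : ∀ x, Tendsto (fun n => h (w n x)) U (𝓝 (h (u x))) := fun x =>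
      (H.cont.tendsto _).comp (hut x)
    have hD := (hut t).sub (hut s)
    have hev := (hτt s).mono fun n hn => mvt_ineq H (hwm n) (hwd n) hn hst
    constructor
    · refine le_of_tendsto_of_tendsto ((((hut t).const_mul (-a)).add
        ((hh (s - 1)).const_mul b)).const_mul (t - s)) hD ?_
      filter_upwards [hev] with n hn using hn.1
    · refine le_of_tendsto_of_tendsto hD ((((hut s).const_mul (-a)).add
        ((hh (t - 1)).const_mul b)).const_mul (t - s)) ?_
      filter_upwards [hev] with n hn using hn.2
  · have : Tendsto (fun n => w n 0) U (𝓝 κ) := by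
      simp only [hw0]; exact tendsto_const_nhds
    exact tendsto_nhds_unique (hut 0) this

lemma core_main {a b ξ B κ : ℝ} {h : ℝ → ℝ} (H : CoreH_s5 a b ξ B h) (hκ : κ ∈ Ioo 0 ξ) :
    ∃ u : ℝ → ℝ,
      (IsSolH a b h u ∧ (∀ t : ℝ, t ≤ 0 → u t ∈ Icc 0 κ) ∧ u 0 = κ) ∧
      StrictMono u ∧ Tendsto u atBot (𝓝 0) ∧ Tendsto u atTop (𝓝 ξ) ∧
      (∀ u' : ℝ → ℝ,
        (IsSolH a b h u' ∧ (∀ t : ℝ, t ≤ 0 → u' t ∈ Icc 0 κ) ∧ u' 0 = κ) → u' = u) := by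
  obtain ⟨u, hu, hum, hur, hu0⟩ := exists_sol H hκ.1 hκ.2
  have hupast : ∀ t : ℝ, t ≤ 0 → u t ∈ Icc 0 κ := fun t ht => ⟨(hur t).1, hu0 ▸ hum ht⟩
  have hbot := tendsto_zero H hu hκ.2 hupast
  refine ⟨u, ⟨hu, hupast, hu0⟩, ?_, hbot, ?_, ?_⟩
  · intro s t hst
    refine lt_of_le_of_ne (hum hst.le) fun heq => ?_
    set σ := t - s with hσ
    have hσ0 : 0 < σ := by linarith
    have hshift : ∀ r, HasDerivAt (fun r => u (r + σ))
        (-a * u (r + σ) + b * h (u (r + σ - 1))) r := fun r =>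
      HasDerivAt.comp_add_const r σ (hu (r + σ))
    have hz : ∀ r ≤ s, u (r + σ) = u r := by
      intro r hrs
      have A := exp_mono_aux (k := a) (f := fun r => u (r + σ) - u r)
        (g := fun r => b * (h (u (r + σ - 1)) - h (u (r - 1)))) hrs
        (by
          have := hu.cont
          fun_prop)
        (by
          intro x _
          refine ((hshift x).sub (hu x)).congr_deriv ?_
          ring)
        (by
          intro x _
          have := H.mono (hum (show x - 1 ≤ x + σ - 1 by linarith))
          exact mul_nonneg H.hb.le (by linarith))
      have e : s + σ = t := by rw [hσ]; ring
      simp only [e, heq, sub_self, zero_mul] at A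
      have h1 : u (r + σ) - u r ≤ 0 := by
        by_contra! hc
        have := mul_pos hc (exp_pos (a * r))
        linarith
      have h2 := hum (show r ≤ r + σ by linarith)
      linarith
    have hn : ∀ n : ℕ, u (s - n * σ) = u s := by
      intro n
      induction n with
      | zero => simp
      | succ n ih =>
        have hp : (0:ℝ) ≤ n * σ := by positivity
        have := hz (s - (n + 1) * σ) (by linarith)
        push_cast
        rw [← this, ← ih]
        congr 1; ring
    have hs0 : u s = 0 := by
      have l1 : Tendsto (fun n : ℕ => s - n * σ) atTop atBot := by
        have : Tendsto (fun n : ℕ => (n:ℝ) * σ) atTop atTop :=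
          tendsto_natCast_atTop_atTop.atTop_mul_const hσ0
        simpa [sub_eq_add_neg] using
          tendsto_atBot_add_const_left atTop s (tendsto_neg_atTop_atBot.comp this)
      have l2 := hbot.comp l1
      have : (u ∘ fun n : ℕ => s - n * σ) = fun _ => u s := funext hn
      rw [this] at l2
      exact tendsto_nhds_unique tendsto_const_nhds l2
    have hzero : IsSolH a b h (fun _ => 0) := by
      intro r
      simpa [H.h0] using hasDerivAt_const r (0:ℝ)
    have := forward_unique hu hzero s fun r hr =>
      le_antisymm (hs0 ▸ hum hr) (hur r).1
    have := congrFun this 0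
    linarith [hκ.1]
  · exact tendsto_top (T := 0) (T' := 0) H hum (fun t => (hur t).2) (by rw [hu0]; exact hκ.1)
      (fun t _ => hu t)
  · rintro u' ⟨h1, h2, h3⟩
    exact past_unique H h1 hu hκ.2 h2 hupast (h3.trans hu0.symm)

lemma condH_mono {a b ξm ξp : ℝ} {h : ℝ → ℝ} (hH : CondH a b ξm ξp h) : Monotone h := by
  have hc : Continuous (deriv h) := hH.smooth.continuous_deriv le_rfl
  have hd : Differentiable ℝ h := hH.smooth.differentiable one_ne_zero
  apply monotone_of_deriv_nonneg hd
  intro x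
  have hcl : IsClosed {x | 0 ≤ deriv h x} := isClosed_le continuous_const hc
  have hde : Dense (({ξm, ξp} : Set ℝ)ᶜ) :=
    Set.Countable.dense_compl ℝ ((Set.toFinite _).countable)
  have hsub : (({ξm, ξp} : Set ℝ)ᶜ) ⊆ {x | 0 ≤ deriv h x} := by
    intro y hy
    simp only [mem_compl_iff, mem_insert_iff, mem_singleton_iff, not_or] at hy
    exact (hH.deriv_pos y hy.1 hy.2).le
  exact hcl.closure_subset_iff.2 hsub (hde x)

lemma condH_near {a b ξm ξp : ℝ} {h : ℝ → ℝ} (hH : CondH a b ξm ξp h) (p q : ℝ)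
    (hp : p < b * deriv h 0) (hq : b * deriv h 0 < q) :
    ∃ x0 > 0, ∀ x y : ℝ, |x| ≤ x0 → |y| ≤ x0 → x ≤ y →
      p * (y - x) ≤ b * (h y - h x) ∧ b * (h y - h x) ≤ q * (y - x) := by
  have hc : Continuous (fun x => b * deriv h x) :=
    (hH.smooth.continuous_deriv le_rfl).const_mul b
  have hd : Differentiable ℝ h := hH.smooth.differentiable one_ne_zero
  have h1 : ∀ᶠ x in 𝓝 (0:ℝ), p < b * deriv h x ∧ b * deriv h x < q :=
    (hc.tendsto 0).eventually (Ioo_mem_nhds hp hq)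
  obtain ⟨ε, hε, hball⟩ := Metric.eventually_nhds_iff.1 h1
  refine ⟨ε / 2, by positivity, fun x y hx hy hxy => ?_⟩
  rcases hxy.eq_or_lt with rfl | hlt
  · simp
  obtain ⟨c, hcm, hc2⟩ := exists_hasDerivAt_eq_slope h (deriv h) hlt
    hd.continuous.continuousOn (fun z _ => (hd z).hasDerivAt)
  have hpos : 0 < y - x := by linarith
  rw [eq_div_iff hpos.ne'] at hc2
  have hcb := hball (y := c) (by
    rw [Real.dist_eq, sub_zero, abs_lt]
    have := abs_le.1 hx
    have := abs_le.1 hy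
    constructor <;> linarith [hcm.1, hcm.2])
  rw [← hc2, ← mul_assoc]
  exact ⟨mul_le_mul_of_nonneg_right hcb.1.le hpos.le, mul_le_mul_of_nonneg_right hcb.2.le hpos.le⟩

lemma condH_core_p {a b ξm ξp : ℝ} {h : ℝ → ℝ} (hH : CondH a b ξm ξp h) :
    CoreH_s5 a b ξp (b * deriv h 0) h where
  ha := hH.a_pos
  hb := hH.b_pos
  hξ := hH.ξp_pos
  cont := hH.smooth.continuous
  mono := condH_mono hH
  h0 := hH.h_zero
  hB := hH.slope_zero
  near := condH_near hH
  zero := by linarith [hH.zero_p]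
  pos := by
    intro x hx hxξ
    have := hH.ratio x (by linarith [hH.ξm_neg]) hxξ hx.ne'
    rw [div_lt_div_iff₀ hH.b_pos hx] at this
    linarith

lemma condH_core_m {a b ξm ξp : ℝ} {h : ℝ → ℝ} (hH : CondH a b ξm ξp h) :
    CoreH_s5 a b (-ξm) (b * deriv h 0) (fun x => -h (-x)) where
  ha := hH.a_pos
  hb := hH.b_pos
  hξ := by linarith [hH.ξm_neg]
  cont := by
    have := hH.smooth.continuous
    fun_prop
  mono := fun x y hxy => neg_le_neg (condH_mono hH (neg_le_neg hxy))
  h0 := by simp [hH.h_zero]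
  hB := hH.slope_zero
  near := by
    intro p q hp hq
    obtain ⟨x0, hx0, hx⟩ := condH_near hH p q hp hq
    refine ⟨x0, hx0, fun x y h1 h2 hxy => ?_⟩
    have := hx (-y) (-x) (by rwa [abs_neg]) (by rwa [abs_neg]) (by linarith)
    have e1 : -x - -y = y - x := by ring
    have e2 : h (-x) - h (-y) = -h (-y) - -h (-x) := by ring
    rwa [e1, e2] at this
  zero := by rw [neg_neg]; linarith [hH.zero_m]
  pos := by
    intro x hx hxξ
    have := hH.ratio (-x) (by linarith) (by linarith [hH.ξp_pos]) (by linarith)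
    rw [← neg_div_neg_eq (h (-x)), neg_neg, div_lt_div_iff₀ hH.b_pos hx] at this
    linarith

lemma IsSolH.neg_sol {a b : ℝ} {h u : ℝ → ℝ} (hu : IsSolH a b h u) :
    IsSolH a b (fun x => -h (-x)) (fun t => -u t) := by
  intro t
  refine (hu t).neg.congr_deriv ?_
  simp only [neg_neg]; ring


/-- under `(H)`, there is exactly one solution on `ℝ` staying in `[0,κ⁺]`
on `(-∞,0]` with value `κ⁺` at `0` (it is strictly increasing with limits `0` and `ξ₊`),
and exactly one solution staying in `[κ⁻,0]` on `(-∞,0]` with value `κ⁻` at `0`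
(it is strictly decreasing with limits `0` and `ξ₋`). -/
theorem stmt_5 (a b ξm ξp : ℝ) (h : ℝ → ℝ) (hH : CondH a b ξm ξp h)
    (κp κm : ℝ) (hκp : κp ∈ Ioo 0 ξp) (hκm : κm ∈ Ioo ξm 0) :
    (∃ u : ℝ → ℝ,
      (IsSolH a b h u ∧ (∀ t : ℝ, t ≤ 0 → u t ∈ Icc 0 κp) ∧ u 0 = κp) ∧
      StrictMono u ∧ Tendsto u atBot (nhds 0) ∧ Tendsto u atTop (nhds ξp) ∧
      (∀ u' : ℝ → ℝ,
        (IsSolH a b h u' ∧ (∀ t : ℝ, t ≤ 0 → u' t ∈ Icc 0 κp) ∧ u' 0 = κp) → u' = u)) ∧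
    (∃ v : ℝ → ℝ,
      (IsSolH a b h v ∧ (∀ t : ℝ, t ≤ 0 → v t ∈ Icc κm 0) ∧ v 0 = κm) ∧
      StrictAnti v ∧ Tendsto v atBot (nhds 0) ∧ Tendsto v atTop (nhds ξm) ∧
      (∀ v' : ℝ → ℝ,
        (IsSolH a b h v' ∧ (∀ t : ℝ, t ≤ 0 → v' t ∈ Icc κm 0) ∧ v' 0 = κm) → v' = v)) := by
  refine ⟨core_main (condH_core_p hH) hκp, ?_⟩
  obtain ⟨u, ⟨hu, hur, hu0⟩, hum, hub, hut, huu⟩ := core_main (κ := -κm) (condH_core_m hH)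
    ⟨by linarith [hκm.2], by linarith [hκm.1]⟩
  refine ⟨fun t => -u t, ⟨?_, ?_, ?_⟩, ?_, ?_, ?_, ?_⟩
  · simpa using hu.neg_sol
  · intro t ht
    have := hur t ht
    exact ⟨by linarith [this.2], by linarith [this.1]⟩
  · simp [hu0]
  · intro s t hst
    exact neg_lt_neg (hum hst)
  · simpa using hub.neg
  · simpa using hut.neg
  · rintro v' ⟨h1, h2, h3⟩
    have := huu (fun t => -v' t) ⟨h1.neg_sol, fun t ht =>
      ⟨by linarith [(h2 t ht).2], by linarith [(h2 t ht).1]⟩, by simp [h3]⟩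
    funext t
    rw [← this]; simp
end
end
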